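/- arXiv:1311.3297 — 2 statements merged into one kernel-verified Lean document; each statement's English description precedes it below -/
import Mathlib

section
/- Suppose that AP(ψ) = ‖ (|1⟩⟨1|)_out · U_C (ψ ⊗ |0⟩^{⊗(n−n_in)}) ‖² ≤ 1/3 for every unit vector ψ ∈ (ℂ²)^{⊗n_in}. Then every eigenvalue of A_x is at least e₁ + 1/(120 M⁴ n), where e₁ = −1 − 3√2. -/
open scoped Matrix

namespace QC

/-- `ω = e^{iπ/4}`. -/
noncomputable def omega : ℂ := Complex.exp (Real.pi * Complex.I / 4)

/-- The cyclic shift on `ℂ⁸`: `S|j⟩ = |j+1 mod 8⟩`. -/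
noncomputable def S8 : Matrix (Fin 8) (Fin 8) ℂ :=
  Matrix.of fun i j => if i = j + 1 then 1 else 0

/-- `|ω⟩ = (1/√8) Σ_{j=0}^{7} ω^{−j} |j⟩`. -/
noncomputable def omegaVec : Fin 8 → ℂ :=
  fun j => ((1 : ℝ) / Real.sqrt 8 : ℝ) * omega ^ (-(j : ℤ))

/-- `|ω*⟩ = (1/√8) Σ_{j=0}^{7} ω^{j} |j⟩`. -/
noncomputable def omegaStarVec : Fin 8 → ℂ :=
  fun j => ((1 : ℝ) / Real.sqrt 8 : ℝ) * omega ^ (j : ℕ)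

/-- The Hadamard gate `H = (1/√2)[[1,1],[1,−1]]`. -/
noncomputable def Hmat : Matrix (Fin 2) (Fin 2) ℂ :=
  ((1 : ℝ) / Real.sqrt 2 : ℝ) • (!![1, 1; 1, -1] : Matrix (Fin 2) (Fin 2) ℂ)

/-- The gate `T = diag(1, ω)`. -/
noncomputable def Tmat : Matrix (Fin 2) (Fin 2) ℂ := !![1, 0; 0, omega]

/-- For a matrix `W` all of whose entries are `0` or integer powers of `ω`, the operator
`B(W)` obtained by replacing each entry `ω^k` by `S^k` (and each zero entry by the zero
block): since `(S^k)_{ij} = [i−j ≡ k (mod 8)]` and the powers `ω^0,…,ω^7` are distinct,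
this is implemented by `B(W)_{(a,i),(b,j)} = [W a b = ω^{(i−j) mod 8}]`. -/
noncomputable def Bmat {κ : Type*} (W : Matrix κ κ ℂ) :
    Matrix (κ × Fin 8) (κ × Fin 8) ℂ :=
  Matrix.of fun p q => if W p.1 q.1 = omega ^ ((p.2 - q.2 : Fin 8) : ℕ) then 1 else 0

/-- Computational basis configurations of `n` qubits. -/
abbrev QState (n : ℕ) := Fin n → Fin 2

/-- A single-qubit gate `g` applied to qubit `q` of `n` qubits (tensored with the
identity on the remaining qubits). -/
noncomputable def applySingle (n : ℕ) (g : Matrix (Fin 2) (Fin 2) ℂ) (q : Fin n) :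
    Matrix (QState n) (QState n) ℂ :=
  Matrix.of fun x y =>
    (if ∀ u, u ≠ q → x u = y u then (1 : ℂ) else 0) * g (x q) (y q)

/-- A two-qubit gate `g` applied to the ordered pair of qubits `(q, r)` of `n` qubits. -/
noncomputable def applyTwo (n : ℕ) (g : Matrix (Fin 2 × Fin 2) (Fin 2 × Fin 2) ℂ)
    (q r : Fin n) : Matrix (QState n) (QState n) ℂ :=
  Matrix.of fun x y =>
    (if ∀ u, u ≠ q → u ≠ r → x u = y u then (1 : ℂ) else 0) * g (x q, x r) (y q, y r)

/-- The controlled-NOT gate (first qubit control): `|a,b⟩ ↦ |a, b⊕a⟩`. -/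
noncomputable def CNOTmat : Matrix (Fin 2 × Fin 2) (Fin 2 × Fin 2) ℂ :=
  Matrix.of fun p q => if p.1 = q.1 ∧ p.2 = q.2 + q.1 then 1 else 0

/-- The two-qubit gate `(H⊗1)·CNOT`. -/
noncomputable def HCNOT : Matrix (Fin 2 × Fin 2) (Fin 2 × Fin 2) ℂ :=
  (Matrix.of fun p q : Fin 2 × Fin 2 =>
    Hmat p.1 q.1 * (if p.2 = q.2 then (1 : ℂ) else 0)) * CNOTmat

/-- A gate of the circuit: one of `H`, `HT`, `(HT)†` applied to a single qubit, or
`(H⊗1)·CNOT` applied to an ordered pair of distinct qubits. -/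
def AllowedGate (n : ℕ) (Ug : Matrix (QState n) (QState n) ℂ) : Prop :=
  (∃ q : Fin n, Ug = applySingle n Hmat q ∨ Ug = applySingle n (Hmat * Tmat) q
      ∨ Ug = applySingle n ((Hmat * Tmat)ᴴ) q)
  ∨ (∃ q r : Fin n, q ≠ r ∧ Ug = applyTwo n HCNOT q r)

/-- `W_t = U_t` for `1 ≤ t ≤ M` and `W_t = U_{2M+1−t}†` for `M+1 ≤ t ≤ 2M`
(0-indexed: `W_s = U_s` for `s < M` and `W_s = (U_{2M−1−s})†` otherwise). -/
noncomputable def Wseq (n M : ℕ) (U : ℕ → Matrix (QState n) (QState n) ℂ) (t : ℕ) :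
    Matrix (QState n) (QState n) ℂ :=
  if t < M then U t else (U (2 * M - 1 - t))ᴴ

/-- The cyclic successor on `Fin m` (realizing the periodic clock convention
`|2M+1⟩ = |1⟩`). -/
def cycSucc {m : ℕ} (s : Fin m) : Fin m :=
  ⟨((s : ℕ) + 1) % m, Nat.mod_lt _ s.pos⟩

/-- The vertex set used in the circuit-to-graph construction:
`(ℂ²)^{⊗n} ⊗ ℂ^{2M} ⊗ ℂ⁸` (clock labels `1,…,2M` represented by `Fin (2M)` with label
`t ↔ index t−1`). -/
abbrev CVertex (n M : ℕ) := QState n × Fin (2 * M) × Fin 8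

/-- `H_prop = Σ_{t=1}^{2M}( (B(W_t)†)_{13}⊗(|t⟩⟨t+1|)_2 + (B(W_t))_{13}⊗(|t+1⟩⟨t|)_2 )`,
where `B(W_t)` is obtained from `−√2·W_t` by the substitution `ω^k ↦ S^k`. -/
noncomputable def HpropC (n M : ℕ) (U : ℕ → Matrix (QState n) (QState n) ℂ) :
    Matrix (CVertex n M) (CVertex n M) ℂ :=
  Matrix.of fun p q => ∑ s : Fin (2 * M),
    ((if p.2.1 = s ∧ q.2.1 = cycSucc s then
        (Bmat ((-(Real.sqrt 2) : ℂ) • Wseq n M U (s : ℕ)))ᴴ (p.1, p.2.2) (q.1, q.2.2)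
      else 0)
      + (if p.2.1 = cycSucc s ∧ q.2.1 = s then
        Bmat ((-(Real.sqrt 2) : ℂ) • Wseq n M U (s : ℕ)) (p.1, p.2.2) (q.1, q.2.2)
      else 0))

/-- `H_penalty = 1 ⊗ 1 ⊗ (S³ + S⁴ + S⁵)`. -/
noncomputable def HpenC (n M : ℕ) : Matrix (CVertex n M) (CVertex n M) ℂ :=
  Matrix.of fun p q =>
    if p.1 = q.1 ∧ p.2.1 = q.2.1 then (S8 ^ 3 + S8 ^ 4 + S8 ^ 5) p.2.2 q.2.2 else 0

/-- `H_input = Σ_{j=n_in+1}^{n} (|1⟩⟨1|)_j ⊗ |1⟩⟨1| ⊗ 1` (the middle projector onto the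
clock state `|1⟩`, which is the clock index `0`). -/
noncomputable def HinC (n M nin : ℕ) : Matrix (CVertex n M) (CVertex n M) ℂ :=
  Matrix.of fun p q =>
    if p = q ∧ (p.2.1 : ℕ) = 0 then
      ((Finset.univ.filter fun j : Fin n => nin ≤ (j : ℕ) ∧ p.1 j = 1).card : ℂ)
    else 0

/-- `H_output = (|0⟩⟨0|)_out ⊗ |M+1⟩⟨M+1| ⊗ 1` (clock label `M+1` is clock index `M`). -/
noncomputable def HoutC (n M : ℕ) (out : Fin n) :
    Matrix (CVertex n M) (CVertex n M) ℂ :=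
  Matrix.of fun p q =>
    if p = q ∧ p.1 out = 0 ∧ (p.2.1 : ℕ) = M then 1 else 0

/-- The symmetric 0-1 matrix `A_x = H_prop + H_penalty + H_input + H_output`. -/
noncomputable def Ax (n M nin : ℕ) (out : Fin n)
    (U : ℕ → Matrix (QState n) (QState n) ℂ) :
    Matrix (CVertex n M) (CVertex n M) ℂ :=
  HpropC n M U + HpenC n M + HinC n M nin + HoutC n M out

/-- `e₁ = −1 − 3√2`. -/
noncomputable def e1 : ℝ := -1 - 3 * Real.sqrt 2

/-- `U_C = U_M ⋯ U_1` (0-indexed: `U_{M−1} ⋯ U_0`). -/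
noncomputable def circuitU (n M : ℕ) (U : ℕ → Matrix (QState n) (QState n) ℂ) :
    Matrix (QState n) (QState n) ℂ :=
  ((List.range M).reverse.map U).prod

/-- The input state `ψ ⊗ |0⟩^{⊗(n−n_in)}` for `ψ ∈ (ℂ²)^{⊗n_in}`. -/
noncomputable def embedInput (n nin : ℕ) (h : nin ≤ n) (ψ : QState nin → ℂ) :
    QState n → ℂ :=
  fun x => (if ∀ j : Fin n, nin ≤ (j : ℕ) → x j = 0 then (1 : ℂ) else 0)
    * ψ (fun i : Fin nin => x (Fin.castLE h i))

/-- The acceptance probability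
`AP(ψ) = ‖ (|1⟩⟨1|)_out · U_C (ψ ⊗ |0⟩^{⊗(n−n_in)}) ‖²`. -/
noncomputable def acceptProb (n M nin : ℕ) (h : nin ≤ n) (out : Fin n)
    (U : ℕ → Matrix (QState n) (QState n) ℂ) (ψ : QState nin → ℂ) : ℝ :=
  ∑ x : QState n,
    if x out = 1 then
      Complex.normSq ((circuitU n M U).mulVec (embedInput n nin h ψ) x)
    else 0

end QC

open QC
namespace QCP

set_option linter.unusedSimpArgs false


lemma omega_prim : IsPrimitiveRoot omega 8 := by
  have h := Complex.isPrimitiveRoot_exp 8 (by norm_num)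
  have : omega = Complex.exp (2 * Real.pi * Complex.I / (8 : ℕ)) := by
    unfold omega; congr 1; push_cast; ring
  rw [this]; exact h

lemma omega_pow8 : omega ^ 8 = 1 := omega_prim.pow_eq_one

lemma omega_re_im : omega.re = Real.sqrt 2 / 2 ∧ omega.im = Real.sqrt 2 / 2 := by
  have : omega = Complex.exp (((Real.pi / 4 : ℝ) : ℂ) * Complex.I) := by
    unfold omega; congr 1; push_cast; ring
  rw [this, Complex.exp_ofReal_mul_I_re, Complex.exp_ofReal_mul_I_im,
    Real.cos_pi_div_four, Real.sin_pi_div_four]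
  exact ⟨rfl, rfl⟩

lemma sq2 : (Real.sqrt 2) * (Real.sqrt 2) = 2 := Real.mul_self_sqrt (by norm_num)

lemma omega_sq : omega ^ 2 = Complex.I := by
  obtain ⟨h1, h2⟩ := omega_re_im
  apply Complex.ext
  · simp [pow_two, h1, h2]
  · simp [pow_two, h1, h2]; nlinarith [sq2]

lemma omega_pow4 : omega ^ 4 = -1 := by
  have : omega ^ 4 = (omega ^ 2) ^ 2 := by ring
  rw [this, omega_sq, Complex.I_sq]

lemma omega_ne : omega ≠ 0 := by
  intro h; have := omega_pow8; rw [h] at this; norm_num at this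

lemma omega_norm : ‖omega‖ = 1 := omega_prim.norm'_eq_one (by norm_num)

lemma root_inv_conj {χ : ℂ} (h : χ ^ 8 = 1) : (starRingEnd ℂ) χ * χ = 1 := by
  have h1 : ‖χ‖ = 1 := Complex.norm_eq_one_of_pow_eq_one h (by norm_num)
  rw [← Complex.normSq_eq_conj_mul_self, Complex.normSq_eq_norm_sq, h1]; norm_num

lemma fin8_add_pow {χ : ℂ} (h : χ ^ 8 = 1) (a b : Fin 8) :
    χ ^ ((a + b : Fin 8) : ℕ) = χ ^ (a : ℕ) * χ ^ (b : ℕ) := by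
  rw [Fin.val_add, ← pow_add, ← pow_eq_pow_mod _ h]

lemma fin8_sub_pow {χ : ℂ} (h : χ ^ 8 = 1) (a b : Fin 8) :
    χ ^ ((a - b : Fin 8) : ℕ) = χ ^ (a : ℕ) * (starRingEnd ℂ) (χ ^ (b : ℕ)) := by
  have h1 := fin8_add_pow h (a - b) b
  rw [sub_add_cancel] at h1
  have h2 : χ ^ (b : ℕ) * (starRingEnd ℂ) (χ ^ (b : ℕ)) = 1 := by
    rw [map_pow, ← mul_pow, mul_comm, root_inv_conj h, one_pow]
  rw [h1, mul_assoc, h2, mul_one]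

lemma omega_fin_inj {a b : Fin 8} (h : omega ^ (a : ℕ) = omega ^ (b : ℕ)) : a = b :=
  Fin.ext (omega_prim.pow_inj a.2 b.2 h)

/-- entries are zero or powers of omega -/
def EntryOK {κ : Type*} (W : Matrix κ κ ℂ) : Prop :=
  ∀ x y, W x y = 0 ∨ ∃ e : Fin 8, W x y = omega ^ (e : ℕ)

noncomputable def Gh {κ : Type*} (χ : ℂ) (W : Matrix κ κ ℂ) : Matrix κ κ ℂ :=
  Matrix.of fun x y => ∑ d : Fin 8, if W x y = omega ^ (d : ℕ) then χ ^ (d : ℕ) else 0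

lemma Gh_cases {κ : Type*} (χ : ℂ) {W : Matrix κ κ ℂ} (hW : EntryOK W) (x y : κ) :
    (W x y = 0 ∧ Gh χ W x y = 0) ∨
      ∃ e : Fin 8, W x y = omega ^ (e : ℕ) ∧ Gh χ W x y = χ ^ (e : ℕ) := by
  rcases hW x y with h | ⟨e, h⟩
  · left
    refine ⟨h, ?_⟩
    simp only [Gh, Matrix.of_apply, h]
    apply Finset.sum_eq_zero
    intro d _
    rw [if_neg]
    intro h'; exact pow_ne_zero _ omega_ne h'.symm
  · right
    refine ⟨e, h, ?_⟩
    simp only [Gh, Matrix.of_apply, h]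
    rw [Finset.sum_eq_single e]
    · simp
    · intro d _ hd
      rw [if_neg]
      intro h'; exact hd (omega_fin_inj h').symm
    · simp

lemma Gh_norm {κ : Type*} {χ : ℂ} (hχ : χ ^ 8 = 1) {W : Matrix κ κ ℂ} (hW : EntryOK W)
    (x y : κ) : ‖Gh χ W x y‖ = ‖W x y‖ ^ 2 := by
  have h1 : ‖χ‖ = 1 := Complex.norm_eq_one_of_pow_eq_one hχ (by norm_num)
  rcases Gh_cases χ hW x y with ⟨a, b⟩ | ⟨e, a, b⟩
  · rw [a, b]; simp
  · rw [a, b]; simp [h1, omega_norm]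

lemma Gh_one {κ : Type*} {W : Matrix κ κ ℂ} (hW : EntryOK W)
    (x y : κ) : Gh omega W x y = W x y := by
  rcases Gh_cases omega hW x y with ⟨a, b⟩ | ⟨e, a, b⟩ <;> rw [a, b]

lemma Gh_seven {κ : Type*} {W : Matrix κ κ ℂ} (hW : EntryOK W)
    (x y : κ) : Gh (omega ^ 7) W x y = (starRingEnd ℂ) (W x y) := by
  have h7 : omega ^ 7 = (starRingEnd ℂ) omega := by
    have h1 := root_inv_conj omega_pow8
    have h2 : omega ^ 7 * omega = 1 := by rw [← pow_succ]; exact omega_pow8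
    exact mul_right_cancel₀ omega_ne (h2.trans h1.symm)
  rcases Gh_cases (omega ^ 7) hW x y with ⟨a, b⟩ | ⟨e, a, b⟩
  · rw [a, b]; simp
  · rw [a, b, h7, map_pow]

/-- real part of the penalty -/
lemma pen_re (k : Fin 8) (hk : k ≠ 1) (hk' : k ≠ 7) :
    -1 ≤ ((omega ^ (k : ℕ)) ^ 3 + (omega ^ (k : ℕ)) ^ 4 + (omega ^ (k : ℕ)) ^ 5).re := by
  obtain ⟨h1, h2⟩ := omega_re_im
  have hs : (0:ℝ) ≤ Real.sqrt 2 := Real.sqrt_nonneg 2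
  have e0 : ∀ m, omega ^ (m + 4) = - omega ^ m := by
    intro m; rw [pow_add, omega_pow4]; ring
  have e3 : omega ^ 3 = Complex.I * omega := by rw [← omega_sq]; ring
  have hk1 : (k : ℕ) ≠ 1 := fun h => hk (Fin.ext h)
  have hk7 : (k : ℕ) ≠ 7 := fun h => hk' (Fin.ext h)
  obtain ⟨k, hk8⟩ := k
  simp only at hk1 hk7 ⊢
  interval_cases k
  all_goals first
    | exact absurd rfl hk1
    | exact absurd rfl hk7
    | (simp only [← pow_mul]
       simp [e0, e3, h1, h2, omega_sq, omega_pow4]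
       try linarith)

lemma pen_re_one :
    ((omega) ^ 3 + (omega) ^ 4 + (omega) ^ 5).re = -1 - Real.sqrt 2 := by
  obtain ⟨h1, h2⟩ := omega_re_im
  have e0 : ∀ m, omega ^ (m + 4) = - omega ^ m := by
    intro m; rw [pow_add, omega_pow4]; ring
  have e3 : omega ^ 3 = Complex.I * omega := by rw [← omega_sq]; ring
  simp [e0, e3, h1, h2, omega_sq, omega_pow4]; ring

lemma pen_re_seven :
    ((omega ^ 7) ^ 3 + (omega ^ 7) ^ 4 + (omega ^ 7) ^ 5).re = -1 - Real.sqrt 2 := by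
  obtain ⟨h1, h2⟩ := omega_re_im
  have e0 : ∀ m, omega ^ (m + 4) = - omega ^ m := by
    intro m; rw [pow_add, omega_pow4]; ring
  have e3 : omega ^ 3 = Complex.I * omega := by rw [← omega_sq]; ring
  simp only [← pow_mul]
  simp [e0, e3, h1, h2, omega_sq, omega_pow4]; ring
/-! ### gates -/

lemma applySingle_mul (n : ℕ) (g h : Matrix (Fin 2) (Fin 2) ℂ) (q : Fin n) :
    applySingle n g q * applySingle n h q = applySingle n (g * h) q := by
  ext x z
  simp only [applySingle, Matrix.mul_apply, Matrix.of_apply]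
  rw [← Finset.sum_of_injOn (s := (Finset.univ : Finset (Fin 2)))
    (f := fun c => (if ∀ u, u ≠ q → x u = z u then (1 : ℂ) else 0) * (g (x q) c * h c (z q)))
    (fun c => Function.update x q c)]
  · rw [← Finset.mul_sum]
  · intro a _ b _ hab
    have := congrFun hab q
    simpa using this
  · intro c _; simp
  · intro y _ hy
    rw [if_neg]
    · simp
    · intro hxy
      apply hy
      refine ⟨y q, by simp, ?_⟩
      funext u
      by_cases hu : u = q
      · subst hu; simp
      · simp [Function.update_of_ne hu, hxy u hu]
  · intro c _
    have h1 : ∀ u, u ≠ q → x u = Function.update x q c u := by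
      intro u hu; simp [Function.update_of_ne hu]
    have h2 : (∀ u, u ≠ q → Function.update x q c u = z u) ↔ (∀ u, u ≠ q → x u = z u) := by
      constructor
      · intro h u hu; rw [h1 u hu]; exact h u hu
      · intro h u hu; rw [← h1 u hu]; exact h u hu
    rw [if_pos h1]
    simp only [h2, Function.update_self]
    ring

lemma applyTwo_mul (n : ℕ) (g h : Matrix (Fin 2 × Fin 2) (Fin 2 × Fin 2) ℂ) (q r : Fin n)
    (hqr : q ≠ r) :
    applyTwo n g q r * applyTwo n h q r = applyTwo n (g * h) q r := by
  ext x z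
  simp only [applyTwo, Matrix.mul_apply, Matrix.of_apply]
  rw [← Finset.sum_of_injOn (s := (Finset.univ : Finset (Fin 2 × Fin 2)))
    (f := fun c => (if ∀ u, u ≠ q → u ≠ r → x u = z u then (1 : ℂ) else 0) *
      (g (x q, x r) c * h c (z q, z r)))
    (fun c => Function.update (Function.update x q c.1) r c.2)]
  · rw [← Finset.mul_sum]
  · intro a _ b _ hab
    have h1 := congrFun hab q
    have h2 := congrFun hab r
    simp [Function.update_of_ne hqr] at h1 h2
    exact Prod.ext h1 h2
  · intro c _; simp
  · intro y _ hy
    rw [if_neg]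
    · simp
    · intro hxy
      apply hy
      refine ⟨(y q, y r), by simp, ?_⟩
      funext u
      by_cases hu : u = r
      · subst hu; simp
      · by_cases hu' : u = q
        · subst hu'; simp [Function.update_of_ne hu]
        · simp [Function.update_of_ne hu, Function.update_of_ne hu', hxy u hu' hu]
  · intro c _
    have h1 : ∀ u, u ≠ q → u ≠ r →
        x u = Function.update (Function.update x q c.1) r c.2 u := by
      intro u hu hu'; simp [Function.update_of_ne hu, Function.update_of_ne hu']
    have h2 : (∀ u, u ≠ q → u ≠ r →
        Function.update (Function.update x q c.1) r c.2 u = z u) ↔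
        (∀ u, u ≠ q → u ≠ r → x u = z u) := by
      constructor
      · intro h u hu hu'; rw [h1 u hu hu']; exact h u hu hu'
      · intro h u hu hu'; rw [← h1 u hu hu']; exact h u hu hu'
    rw [if_pos h1]
    simp only [h2, Function.update_self, Function.update_of_ne hqr]
    simp only [Prod.mk.eta]
    ring

lemma applySingle_one (n : ℕ) (q : Fin n) : applySingle n 1 q = 1 := by
  ext x y
  simp only [applySingle, Matrix.of_apply, Matrix.one_apply]
  by_cases h : x = y
  · subst h; simp
  · rw [if_neg h]
    by_cases h1 : ∀ u, u ≠ q → x u = y u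
    · rw [if_pos h1, one_mul, if_neg]
      intro h2; apply h; funext u
      by_cases hu : u = q
      · subst hu; exact h2
      · exact h1 u hu
    · rw [if_neg h1, zero_mul]

lemma applyTwo_one (n : ℕ) (q r : Fin n) : applyTwo n 1 q r = 1 := by
  ext x y
  simp only [applyTwo, Matrix.of_apply, Matrix.one_apply]
  by_cases h : x = y
  · subst h; simp
  · rw [if_neg h]
    by_cases h1 : ∀ u, u ≠ q → u ≠ r → x u = y u
    · rw [if_pos h1, one_mul, if_neg]
      intro h2; apply h; funext u
      by_cases hu : u = q
      · subst hu; exact (Prod.ext_iff.1 h2).1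
      · by_cases hu' : u = r
        · subst hu'; exact (Prod.ext_iff.1 h2).2
        · exact h1 u hu hu'
    · rw [if_neg h1, zero_mul]

lemma applySingle_conj (n : ℕ) (g : Matrix (Fin 2) (Fin 2) ℂ) (q : Fin n) :
    (applySingle n g q)ᴴ = applySingle n gᴴ q := by
  ext x y
  simp only [applySingle, Matrix.of_apply, Matrix.conjTranspose_apply]
  have : (∀ u, u ≠ q → y u = x u) ↔ (∀ u, u ≠ q → x u = y u) := by
    constructor <;> intro h u hu <;> exact (h u hu).symm
  simp only [this]
  split_ifs <;> simp

lemma applyTwo_conj (n : ℕ) (g : Matrix (Fin 2 × Fin 2) (Fin 2 × Fin 2) ℂ) (q r : Fin n) :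
    (applyTwo n g q r)ᴴ = applyTwo n gᴴ q r := by
  ext x y
  simp only [applyTwo, Matrix.of_apply, Matrix.conjTranspose_apply]
  have : (∀ u, u ≠ q → u ≠ r → y u = x u) ↔ (∀ u, u ≠ q → u ≠ r → x u = y u) := by
    constructor <;> intro h u hu hu' <;> exact (h u hu hu').symm
  simp only [this]
  split_ifs <;> simp

lemma inv_sq2 : ((Real.sqrt 2 : ℝ) : ℂ)⁻¹ * ((Real.sqrt 2 : ℝ) : ℂ)⁻¹ = 1 / 2 := by
  rw [← mul_inv, ← Complex.ofReal_mul, sq2]; norm_num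

lemma Hmat_unit : Hmat * Hmatᴴ = 1 := by
  have h := inv_sq2
  have h0 : (2:ℂ)⁻¹ + 2⁻¹ = 1 := by norm_num
  ext i j
  fin_cases i <;> fin_cases j <;>
    simp [Hmat, Matrix.mul_apply, Fin.sum_univ_two, Matrix.one_apply, h, h0]

lemma Tmat_unit : Tmat * Tmatᴴ = 1 := by
  have h := root_inv_conj omega_pow8
  rw [mul_comm] at h
  ext i j
  fin_cases i <;> fin_cases j <;>
    simp [Tmat, Matrix.mul_apply, Fin.sum_univ_two, Matrix.one_apply, h]

lemma HT_unit : (Hmat * Tmat) * (Hmat * Tmat)ᴴ = 1 := by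
  rw [Matrix.conjTranspose_mul, Matrix.mul_assoc, ← Matrix.mul_assoc Tmat, Tmat_unit,
    Matrix.one_mul, Hmat_unit]

lemma HCNOT_apply (p q : Fin 2 × Fin 2) :
    HCNOT p q = Hmat p.1 q.1 * (if p.2 = q.2 + q.1 then 1 else 0) := by
  simp only [HCNOT, CNOTmat, Matrix.mul_apply, Matrix.of_apply]
  rw [Finset.sum_eq_single (q.1, q.2 + q.1)]
  · simp
  · intro b _ hb
    rw [if_neg (c := b.1 = q.1 ∧ _), mul_zero]
    intro h; exact hb (Prod.ext h.1 h.2)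
  · simp

lemma HCNOT_unit : HCNOT * HCNOTᴴ = 1 := by
  have h := inv_sq2
  have h0 : (2:ℂ)⁻¹ + 2⁻¹ = 1 := by norm_num
  ext ⟨a, b⟩ ⟨c, d⟩
  simp only [Matrix.mul_apply, Matrix.conjTranspose_apply, HCNOT_apply, Fintype.sum_prod_type,
    Fin.sum_univ_two]
  fin_cases a <;> fin_cases b <;> fin_cases c <;> fin_cases d <;>
    simp [Hmat, Matrix.one_apply, h, h0]

lemma gate_unit {n : ℕ} {G : Matrix (QState n) (QState n) ℂ} (h : AllowedGate n G) :
    G * Gᴴ = 1 := by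
  rcases h with ⟨q, h | h | h⟩ | ⟨q, r, hqr, h⟩
  · rw [h, applySingle_conj, applySingle_mul, Hmat_unit, applySingle_one]
  · rw [h, applySingle_conj, applySingle_mul, HT_unit, applySingle_one]
  · rw [h, applySingle_conj, applySingle_mul, Matrix.conjTranspose_conjTranspose,
      mul_eq_one_comm.1 HT_unit, applySingle_one]
  · rw [h, applyTwo_conj, applyTwo_mul _ _ _ _ _ hqr, HCNOT_unit, applyTwo_one]

lemma ok_one : ∃ e : Fin 8, (1:ℂ) = omega ^ (e : ℕ) := ⟨0, by simp⟩
lemma ok_neg_one : ∃ e : Fin 8, (-1:ℂ) = omega ^ (e : ℕ) := ⟨4, by simp [omega_pow4]⟩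

lemma pow_ok (m : ℕ) : ∃ e : Fin 8, omega ^ m = omega ^ (e : ℕ) :=
  ⟨⟨m % 8, Nat.mod_lt _ (by norm_num)⟩, pow_eq_pow_mod _ omega_pow8⟩

lemma ok_conj {z : ℂ} (h : ∃ e : Fin 8, z = omega ^ (e : ℕ)) :
    ∃ e : Fin 8, (starRingEnd ℂ) z = omega ^ (e : ℕ) := by
  obtain ⟨e, rfl⟩ := h
  refine ⟨0 - e, ?_⟩
  rw [fin8_sub_pow omega_pow8]; simp

lemma sq2c_ne : ((Real.sqrt 2 : ℝ) : ℂ) ≠ 0 := by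
  simp

lemma Hmat_entry (a b : Fin 2) :
    ∃ e : Fin 8, (-(Real.sqrt 2) : ℂ) * Hmat a b = omega ^ (e : ℕ) := by
  have h4 := omega_pow4
  by_cases h : a = 1 ∧ b = 1
  · obtain ⟨rfl, rfl⟩ := h
    refine ⟨0, ?_⟩
    simp [Hmat]
  · refine ⟨4, ?_⟩
    fin_cases a <;> fin_cases b <;> simp_all [Hmat]

lemma HT_entry (a b : Fin 2) :
    ∃ e : Fin 8, (-(Real.sqrt 2) : ℂ) * (Hmat * Tmat) a b = omega ^ (e : ℕ) := by
  have : ∃ m : ℕ, (Hmat * Tmat) a b = Hmat a b * omega ^ m := by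
    refine ⟨(b : ℕ), ?_⟩
    fin_cases b <;> simp [Matrix.mul_apply, Tmat, Fin.sum_univ_two]
  obtain ⟨m, hm⟩ := this
  obtain ⟨e, he⟩ := Hmat_entry a b
  rw [hm, ← mul_assoc, he, ← pow_add]
  exact pow_ok _

lemma entry_conj {κ : Type*} {W : Matrix κ κ ℂ} (h : EntryOK ((-(Real.sqrt 2) : ℂ) • W)) :
    EntryOK ((-(Real.sqrt 2) : ℂ) • Wᴴ) := by
  intro x y
  have e : ((-(Real.sqrt 2) : ℂ) • Wᴴ) x y = (starRingEnd ℂ) (((-(Real.sqrt 2) : ℂ) • W) y x) := by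
    simp [Matrix.smul_apply]
  rw [e]
  rcases h y x with h | h
  · left; rw [h]; simp
  · right; exact ok_conj h

lemma single_entry {n : ℕ} {g : Matrix (Fin 2) (Fin 2) ℂ} (q : Fin n)
    (h : ∀ a b, ∃ e : Fin 8, (-(Real.sqrt 2) : ℂ) * g a b = omega ^ (e : ℕ)) :
    EntryOK ((-(Real.sqrt 2) : ℂ) • applySingle n g q) := by
  intro x y
  simp only [Matrix.smul_apply, applySingle, Matrix.of_apply, smul_eq_mul]
  split_ifs
  · right; rw [one_mul]; exact h _ _
  · left; simp

lemma gate_entry {n : ℕ} {G : Matrix (QState n) (QState n) ℂ} (h : AllowedGate n G) :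
    EntryOK ((-(Real.sqrt 2) : ℂ) • G) := by
  rcases h with ⟨q, h | h | h⟩ | ⟨q, r, hqr, h⟩
  · rw [h]; exact single_entry q Hmat_entry
  · rw [h]; exact single_entry q HT_entry
  · rw [h, ← applySingle_conj]; exact entry_conj (single_entry q HT_entry)
  · rw [h]
    intro x y
    simp only [Matrix.smul_apply, applyTwo, Matrix.of_apply, smul_eq_mul, HCNOT_apply]
    split_ifs
    · right; rw [one_mul, mul_one]; exact Hmat_entry _ _
    · left; simp
    · left; simp
    · left; simp

lemma W_unit {n M : ℕ} {U : ℕ → Matrix (QState n) (QState n) ℂ}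
    (hU : ∀ i, i < M → AllowedGate n (U i)) {t : ℕ} (ht : t < 2 * M) :
    Wseq n M U t * (Wseq n M U t)ᴴ = 1 := by
  unfold Wseq
  split_ifs with h
  · exact gate_unit (hU t h)
  · rw [Matrix.conjTranspose_conjTranspose]
    exact mul_eq_one_comm.1 (gate_unit (hU _ (by omega)))

lemma W_entry {n M : ℕ} {U : ℕ → Matrix (QState n) (QState n) ℂ}
    (hU : ∀ i, i < M → AllowedGate n (U i)) {t : ℕ} (ht : t < 2 * M) :
    EntryOK ((-(Real.sqrt 2) : ℂ) • Wseq n M U t) := by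
  unfold Wseq
  split_ifs with h
  · exact gate_entry (hU t h)
  · exact entry_conj (gate_entry (hU _ (by omega)))
/-! ### sector reduction -/

def Inter {n M : ℕ} (χ : ℂ) (A : Matrix (CVertex n M) (CVertex n M) ℂ)
    (Ah : QState n → Fin (2 * M) → QState n → Fin (2 * M) → ℂ) : Prop :=
  ∀ x t y t' j, ∑ i : Fin 8, χ ^ (i : ℕ) * A (x, t, i) (y, t', j) = Ah x t y t' * χ ^ (j : ℕ)

lemma Inter.add {n M : ℕ} {χ : ℂ} {A B : Matrix (CVertex n M) (CVertex n M) ℂ}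
    {Ah Bh : QState n → Fin (2 * M) → QState n → Fin (2 * M) → ℂ}
    (hA : Inter χ A Ah) (hB : Inter χ B Bh) :
    Inter χ (A + B) (fun x t y t' => Ah x t y t' + Bh x t y t') := by
  intro x t y t' j
  simp only [Matrix.add_apply, mul_add, Finset.sum_add_distrib, add_mul]
  rw [hA, hB]

noncomputable def sec {n M : ℕ} (χ : ℂ) (v : CVertex n M → ℂ) (x : QState n) (t : Fin (2 * M)) : ℂ :=
  ∑ j : Fin 8, χ ^ (j : ℕ) * v (x, t, j)

lemma Inter.mulVec {n M : ℕ} {χ : ℂ} {A : Matrix (CVertex n M) (CVertex n M) ℂ}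
    {Ah : QState n → Fin (2 * M) → QState n → Fin (2 * M) → ℂ}
    (hA : Inter χ A Ah) (v : CVertex n M → ℂ) (x : QState n) (t : Fin (2 * M)) :
    sec χ (A *ᵥ v) x t = ∑ y, ∑ t', Ah x t y t' * sec χ v y t' := by
  simp only [sec, Matrix.mulVec, dotProduct, Finset.mul_sum]
  rw [Finset.sum_comm]
  simp only [Fintype.sum_prod_type]
  refine Finset.sum_congr rfl fun y _ => Finset.sum_congr rfl fun t' _ =>
    Finset.sum_congr rfl fun j _ => ?_
  rw [← mul_assoc, ← hA x t y t' j, Finset.sum_mul]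
  refine Finset.sum_congr rfl fun i _ => ?_
  ring

lemma S8_inter {χ : ℂ} (h : χ ^ 8 = 1) (m : ℕ) (j : Fin 8) :
    ∑ i : Fin 8, χ ^ (i : ℕ) * (S8 ^ m) i j = χ ^ m * χ ^ (j : ℕ) := by
  induction m generalizing j with
  | zero => simp [Matrix.one_apply]
  | succ m ih =>
    simp only [pow_succ S8, Matrix.mul_apply, Finset.mul_sum]
    rw [Finset.sum_comm]
    simp only [← mul_assoc]
    simp only [← Finset.sum_mul, ih]
    simp only [S8, Matrix.of_apply, mul_ite, mul_one, mul_zero, Finset.sum_ite_eq',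
      Finset.mem_univ, if_true]
    rw [fin8_add_pow h]
    simp [pow_succ]; ring

lemma pen_inter {n M : ℕ} {χ : ℂ} (h : χ ^ 8 = 1) :
    Inter χ (HpenC n M) (fun x t y t' => if x = y ∧ t = t' then χ ^ 3 + χ ^ 4 + χ ^ 5 else 0) := by
  intro x t y t' j
  simp only [HpenC, Matrix.of_apply]
  split_ifs
  · simp only [Matrix.add_apply, mul_add, Finset.sum_add_distrib, S8_inter h, add_mul]
  · simp

lemma in_inter {n M nin : ℕ} {χ : ℂ} :
    Inter χ (HinC n M nin) (fun x t y t' => if x = y ∧ t = t' then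
      (if (t : ℕ) = 0 then
      ((Finset.univ.filter fun j : Fin n => nin ≤ (j : ℕ) ∧ x j = 1).card : ℂ) else 0) else 0) := by
  intro x t y t' j
  simp only [HinC, Matrix.of_apply, Prod.mk.injEq]
  by_cases hxy : x = y ∧ t = t'
  · obtain ⟨rfl, rfl⟩ := hxy
    by_cases ht : (t : ℕ) = 0
    · simp [ht, mul_comm]
    · simp [ht]
  · rw [if_neg hxy, zero_mul]
    refine Finset.sum_eq_zero fun i _ => ?_
    rw [if_neg (by tauto), mul_zero]

lemma out_inter {n M : ℕ} {out : Fin n} {χ : ℂ} :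
    Inter χ (HoutC n M out) (fun x t y t' => if x = y ∧ t = t' then
      (if x out = 0 ∧ (t : ℕ) = M then 1 else 0) else 0) := by
  intro x t y t' j
  simp only [HoutC, Matrix.of_apply, Prod.mk.injEq]
  by_cases hxy : x = y ∧ t = t'
  · obtain ⟨rfl, rfl⟩ := hxy
    by_cases ht : x out = 0 ∧ (t : ℕ) = M
    · simp [ht]
    · simp [ht]
  · rw [if_neg hxy, zero_mul]
    refine Finset.sum_eq_zero fun i _ => ?_
    rw [if_neg (by tauto), mul_zero]

lemma Bmat_inter {κ : Type*} {χ : ℂ} (h : χ ^ 8 = 1) (W : Matrix κ κ ℂ) (x y : κ) (j : Fin 8) :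
    ∑ i : Fin 8, χ ^ (i : ℕ) * Bmat W (x, i) (y, j) = Gh χ W x y * χ ^ (j : ℕ) := by
  simp only [Bmat, Gh, Matrix.of_apply, Finset.sum_mul]
  rw [← Equiv.sum_comp (Equiv.addRight j)]
  refine Finset.sum_congr rfl fun d _ => ?_
  simp only [Equiv.coe_addRight, add_sub_cancel_right]
  rw [fin8_add_pow h]
  split_ifs <;> simp

lemma BmatH_inter {κ : Type*} {χ : ℂ} (h : χ ^ 8 = 1) (W : Matrix κ κ ℂ) (x y : κ) (j : Fin 8) :
    ∑ i : Fin 8, χ ^ (i : ℕ) * (Bmat W)ᴴ (x, i) (y, j) =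
      (starRingEnd ℂ) (Gh χ W y x) * χ ^ (j : ℕ) := by
  simp only [Bmat, Gh, Matrix.of_apply, map_sum, Finset.sum_mul, Matrix.conjTranspose_apply]
  rw [← Equiv.sum_comp (Equiv.subLeft j)]
  refine Finset.sum_congr rfl fun d _ => ?_
  simp only [Equiv.subLeft_apply, sub_sub_cancel]
  rw [fin8_sub_pow h]
  split_ifs <;> simp [mul_comm]

lemma prop_inter {n M : ℕ} {χ : ℂ} (h : χ ^ 8 = 1) (U : ℕ → Matrix (QState n) (QState n) ℂ) :
    Inter χ (HpropC n M U) (fun x t y t' => ∑ s : Fin (2 * M),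
      ((if t = s ∧ t' = cycSucc s then
        (starRingEnd ℂ) (Gh χ ((-(Real.sqrt 2) : ℂ) • Wseq n M U (s : ℕ)) y x) else 0)
      + (if t = cycSucc s ∧ t' = s then
        Gh χ ((-(Real.sqrt 2) : ℂ) • Wseq n M U (s : ℕ)) x y else 0))) := by
  intro x t y t' j
  simp only [HpropC, Matrix.of_apply, Finset.mul_sum, Finset.sum_mul]
  rw [Finset.sum_comm]
  refine Finset.sum_congr rfl fun s _ => ?_
  simp only [mul_add, add_mul, Finset.sum_add_distrib]
  congr 1
  · split_ifs
    · exact BmatH_inter h _ _ _ _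
    · simp
  · split_ifs
    · exact Bmat_inter h _ _ _ _
    · simp

/-- the diagonal part -/
noncomputable def dg {n M : ℕ} (nin : ℕ) (out : Fin n) (x : QState n) (t : Fin (2 * M)) : ℝ :=
  (if (t : ℕ) = 0 then
      ((Finset.univ.filter fun j : Fin n => nin ≤ (j : ℕ) ∧ x j = 1).card : ℝ) else 0)
  + (if x out = 0 ∧ (t : ℕ) = M then 1 else 0)

lemma diag_sum {n M : ℕ} (f : QState n → Fin (2 * M) → ℂ) (u : QState n → Fin (2 * M) → ℂ)
    (x : QState n) (t : Fin (2 * M)) :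
    ∑ y, ∑ t', (if x = y ∧ t = t' then f x t else 0) * u y t' = f x t * u x t := by
  rw [Finset.sum_eq_single x, Finset.sum_eq_single t]
  · simp
  · intro b _ hb; rw [if_neg]; · simp
    · rintro ⟨_, rfl⟩; exact hb rfl
  · simp
  · intro b _ hb
    refine Finset.sum_eq_zero fun t' _ => ?_
    rw [if_neg]; · simp
    · rintro ⟨rfl, _⟩; exact hb rfl
  · simp

lemma split4 {n M : ℕ} (a b c d : QState n → Fin (2 * M) → ℂ) (u : QState n → Fin (2 * M) → ℂ) :
    ∑ y, ∑ t', (a y t' + b y t' + c y t' + d y t') * u y t' =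
      ∑ y, ∑ t', a y t' * u y t' + ∑ y, ∑ t', b y t' * u y t' + ∑ y, ∑ t', c y t' * u y t'
        + ∑ y, ∑ t', d y t' * u y t' := by
  simp only [add_mul, Finset.sum_add_distrib]

lemma split3 {n M : ℕ} (w a b c : QState n → Fin (2 * M) → ℂ) :
    ∑ t, ∑ x, w x t * (a x t + b x t + c x t) =
      ∑ t, ∑ x, w x t * a x t + ∑ t, ∑ x, w x t * b x t + ∑ t, ∑ x, w x t * c x t := by
  simp only [mul_add, Finset.sum_add_distrib]

lemma sec_eq {n M nin : ℕ} {out : Fin n} {χ : ℂ} (h : χ ^ 8 = 1)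
    (U : ℕ → Matrix (QState n) (QState n) ℂ) (v : CVertex n M → ℂ) (μ : ℝ)
    (hv : Ax n M nin out U *ᵥ v = (μ : ℂ) • v) (x : QState n) (t : Fin (2 * M)) :
    (μ : ℂ) * sec χ v x t = (∑ y, ∑ t', (∑ s : Fin (2 * M),
      ((if t = s ∧ t' = cycSucc s then
        (starRingEnd ℂ) (Gh χ ((-(Real.sqrt 2) : ℂ) • Wseq n M U (s : ℕ)) y x) else 0)
      + (if t = cycSucc s ∧ t' = s then
        Gh χ ((-(Real.sqrt 2) : ℂ) • Wseq n M U (s : ℕ)) x y else 0))) * sec χ v y t')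
      + (χ ^ 3 + χ ^ 4 + χ ^ 5) * sec χ v x t + (dg nin out x t : ℂ) * sec χ v x t := by
  have e1 : sec χ (Ax n M nin out U *ᵥ v) x t = (μ : ℂ) * sec χ v x t := by
    rw [hv]
    simp only [sec, Pi.smul_apply, smul_eq_mul, Finset.mul_sum]
    refine Finset.sum_congr rfl fun j _ => ?_
    ring
  rw [← e1, Ax, ((((prop_inter h U).add (pen_inter h)).add (in_inter (nin := nin))).add
    (out_inter (out := out))).mulVec]
  rw [split4, diag_sum (fun _ _ => χ ^ 3 + χ ^ 4 + χ ^ 5),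
    diag_sum (fun x t => (if (t : ℕ) = 0 then
      ((Finset.univ.filter fun j : Fin n => nin ≤ (j : ℕ) ∧ x j = 1).card : ℂ) else 0)),
    diag_sum (fun x t => if x out = 0 ∧ (t : ℕ) = M then 1 else 0)]
  rw [add_assoc _ (_ * _) (_ * _), ← add_mul]
  congr 2
  simp only [dg]
  push_cast
  congr 1 <;> split_ifs <;> simp

lemma prop_form {n M : ℕ} (G : Fin (2 * M) → Matrix (QState n) (QState n) ℂ)
    (u : QState n → Fin (2 * M) → ℂ) :
    ∑ t, ∑ x, (starRingEnd ℂ) (u x t) * (∑ y, ∑ t', (∑ s : Fin (2 * M),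
      ((if t = s ∧ t' = cycSucc s then (starRingEnd ℂ) (G s y x) else 0)
      + (if t = cycSucc s ∧ t' = s then G s x y else 0))) * u y t')
    = ∑ s, ((∑ x, ∑ y, (starRingEnd ℂ) (u x s) * (starRingEnd ℂ) (G s y x) * u y (cycSucc s)) +
      ∑ x, ∑ y, (starRingEnd ℂ) (u x (cycSucc s)) * G s x y * u y s) := by
  have h1 : ∀ x y s, (starRingEnd ℂ) (u x s) * (starRingEnd ℂ) (G s y x) * u y (cycSucc s) =
      ∑ t, ∑ t', (starRingEnd ℂ) (u x t) *
        (if t = s ∧ t' = cycSucc s then (starRingEnd ℂ) (G s y x) else 0) * u y t' := by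
    intro x y s
    rw [Finset.sum_eq_single s, Finset.sum_eq_single (cycSucc s)]
    · simp
    · intro b _ hb; simp [hb]
    · simp
    · intro b _ hb; simp [hb]
    · simp
  have h2 : ∀ x y s, (starRingEnd ℂ) (u x (cycSucc s)) * G s x y * u y s =
      ∑ t, ∑ t', (starRingEnd ℂ) (u x t) *
        (if t = cycSucc s ∧ t' = s then G s x y else 0) * u y t' := by
    intro x y s
    rw [Finset.sum_eq_single (cycSucc s), Finset.sum_eq_single s]
    · simp
    · intro b _ hb; simp [hb]
    · simp
    · intro b _ hb; simp [hb]
    · simp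
  simp only [h1, h2, ← Finset.sum_add_distrib]
  rw [Finset.sum_comm]
  conv_rhs => rw [Finset.sum_comm]
  refine Finset.sum_congr rfl fun x _ => ?_
  simp only [Finset.mul_sum, Finset.sum_mul]
  rw [Finset.sum_comm]
  conv_rhs => rw [Finset.sum_comm]
  refine Finset.sum_congr rfl fun y _ => ?_
  conv_rhs => rw [Finset.sum_comm]
  refine Finset.sum_congr rfl fun t _ => ?_
  conv_rhs => rw [Finset.sum_comm]
  refine Finset.sum_congr rfl fun t' _ => ?_
  refine Finset.sum_congr rfl fun s _ => ?_
  ring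

lemma sector_quad {n M nin : ℕ} {out : Fin n} {χ : ℂ} (h : χ ^ 8 = 1)
    (U : ℕ → Matrix (QState n) (QState n) ℂ) (v : CVertex n M → ℂ) (μ : ℝ)
    (hv : Ax n M nin out U *ᵥ v = (μ : ℂ) • v) :
    μ * ∑ t, ∑ x, ‖sec χ v x t‖ ^ 2 =
      2 * (∑ s : Fin (2 * M), (∑ x, ∑ y, (starRingEnd ℂ) (sec χ v x (cycSucc s)) *
        Gh χ ((-(Real.sqrt 2) : ℂ) • Wseq n M U (s : ℕ)) x y * sec χ v y s).re)
      + (χ ^ 3 + χ ^ 4 + χ ^ 5).re * ∑ t, ∑ x, ‖sec χ v x t‖ ^ 2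
      + ∑ t, ∑ x, dg nin out x t * ‖sec χ v x t‖ ^ 2 := by
  have hc : ∀ z : ℂ, (starRingEnd ℂ) z * z = ((‖z‖ ^ 2 : ℝ) : ℂ) := by
    intro z; rw [← Complex.normSq_eq_conj_mul_self, Complex.normSq_eq_norm_sq]
  have key : ∑ t, ∑ x, (starRingEnd ℂ) (sec χ v x t) * ((μ : ℂ) * sec χ v x t) =
     ∑ t, ∑ x, (starRingEnd ℂ) (sec χ v x t) * ((∑ y, ∑ t', (∑ s : Fin (2 * M),
      ((if t = s ∧ t' = cycSucc s then
        (starRingEnd ℂ) (Gh χ ((-(Real.sqrt 2) : ℂ) • Wseq n M U (s : ℕ)) y x) else 0)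
      + (if t = cycSucc s ∧ t' = s then
        Gh χ ((-(Real.sqrt 2) : ℂ) • Wseq n M U (s : ℕ)) x y else 0))) * sec χ v y t')
      + (χ ^ 3 + χ ^ 4 + χ ^ 5) * sec χ v x t + (dg nin out x t : ℂ) * sec χ v x t) := by
    refine Finset.sum_congr rfl fun t _ => Finset.sum_congr rfl fun x _ => ?_
    rw [sec_eq h U v μ hv]
  rw [split3 (fun x t => (starRingEnd ℂ) (sec χ v x t))] at key
  rw [prop_form (fun s => Gh χ ((-(Real.sqrt 2) : ℂ) • Wseq n M U (s : ℕ))) (sec χ v)] at key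
  simp only [mul_left_comm ((starRingEnd ℂ) (sec χ v _ _)) _ (sec χ v _ _), hc] at key
  simp only [← Finset.mul_sum, ← Complex.ofReal_sum, ← Complex.ofReal_mul] at key
  have k2 := congrArg Complex.re key
  simp only [Complex.add_re, Complex.ofReal_re, Complex.re_mul_ofReal, Complex.re_sum (Finset.univ : Finset (Fin (2 * M)))] at k2
  rw [k2]
  congr 2
  rw [Finset.mul_sum]
  refine Finset.sum_congr rfl fun s _ => ?_
  have : (∑ x, ∑ y, (starRingEnd ℂ) (sec χ v x s) *
      (starRingEnd ℂ) (Gh χ ((-(Real.sqrt 2) : ℂ) • Wseq n M U (s : ℕ)) y x) *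
        sec χ v y (cycSucc s)) = (starRingEnd ℂ) (∑ x, ∑ y, (starRingEnd ℂ)
        (sec χ v x (cycSucc s)) *
        Gh χ ((-(Real.sqrt 2) : ℂ) • Wseq n M U (s : ℕ)) x y * sec χ v y s) := by
    simp only [map_sum, map_mul, Complex.conj_conj]
    rw [Finset.sum_comm]
    refine Finset.sum_congr rfl fun x _ => Finset.sum_congr rfl fun y _ => ?_
    ring
  rw [this, Complex.conj_re]
  ring
/-! ### norms -/

lemma unit_row {κ : Type*} [Fintype κ] [DecidableEq κ] {W : Matrix κ κ ℂ} (h : W * Wᴴ = 1) (x : κ) :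
    ∑ y, ‖W x y‖ ^ 2 = 1 := by
  have := congrFun (congrFun h x) x
  simp only [Matrix.mul_apply, Matrix.conjTranspose_apply, Matrix.one_apply_eq, RCLike.star_def,
    Complex.mul_conj, Complex.normSq_eq_norm_sq] at this
  exact_mod_cast this

lemma unit_col {κ : Type*} [Fintype κ] [DecidableEq κ] {W : Matrix κ κ ℂ} (h : W * Wᴴ = 1) (y : κ) :
    ∑ x, ‖W x y‖ ^ 2 = 1 := by
  have h' : Wᴴ * (Wᴴ)ᴴ = 1 := by
    rw [Matrix.conjTranspose_conjTranspose]; exact mul_eq_one_comm.1 h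
  have := unit_row h' y
  simpa using this

lemma unit_isom {κ : Type*} [Fintype κ] [DecidableEq κ] {W : Matrix κ κ ℂ} (h : W * Wᴴ = 1)
    (f : κ → ℂ) : ∑ x, ‖(W *ᵥ f) x‖ ^ 2 = ∑ x, ‖f x‖ ^ 2 := by
  have hh : Wᴴ * W = 1 := mul_eq_one_comm.1 h
  have hc : ∀ g : κ → ℂ, star g ⬝ᵥ g = ((∑ x, ‖g x‖ ^ 2 : ℝ) : ℂ) := by
    intro g
    simp only [dotProduct, Pi.star_apply, RCLike.star_def]
    rw [Complex.ofReal_sum]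
    refine Finset.sum_congr rfl fun x _ => ?_
    rw [← Complex.normSq_eq_conj_mul_self, Complex.normSq_eq_norm_sq]
  have : star (W *ᵥ f) ⬝ᵥ (W *ᵥ f) = star f ⬝ᵥ f := by
    rw [Matrix.star_mulVec, ← Matrix.dotProduct_mulVec, Matrix.mulVec_mulVec, hh, Matrix.one_mulVec]
  rw [hc, hc] at this
  exact_mod_cast this

lemma schur {κ : Type*} [Fintype κ] [DecidableEq κ] {G : Matrix κ κ ℂ}
    (hr : ∀ x, ∑ y, ‖G x y‖ = 2) (hcl : ∀ y, ∑ x, ‖G x y‖ = 2) (a b : κ → ℂ) :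
    -(2 * ∑ x, ‖a x‖ ^ 2 + 2 * ∑ x, ‖b x‖ ^ 2) ≤
      2 * (∑ x, ∑ y, (starRingEnd ℂ) (a x) * G x y * b y).re := by
  have h1 : ∑ x, ∑ y, ‖G x y‖ * ‖a x‖ ^ 2 = 2 * ∑ x, ‖a x‖ ^ 2 := by
    rw [Finset.mul_sum]
    refine Finset.sum_congr rfl fun x _ => ?_
    rw [← Finset.sum_mul, hr]
  have h2 : ∑ x, ∑ y, ‖G x y‖ * ‖b y‖ ^ 2 = 2 * ∑ x, ‖b x‖ ^ 2 := by
    rw [Finset.mul_sum, Finset.sum_comm]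
    refine Finset.sum_congr rfl fun x _ => ?_
    rw [← Finset.sum_mul, hcl]
  rw [← h1, ← h2, Complex.re_sum, Finset.mul_sum, ← Finset.sum_add_distrib,
    ← Finset.sum_neg_distrib]
  refine Finset.sum_le_sum fun x _ => ?_
  rw [Complex.re_sum, Finset.mul_sum, ← Finset.sum_add_distrib, ← Finset.sum_neg_distrib]
  refine Finset.sum_le_sum fun y _ => ?_
  have h3 := (Complex.abs_re_le_norm ((starRingEnd ℂ) (a x) * G x y * b y))
  rw [norm_mul, norm_mul, Complex.norm_conj] at h3
  have h4 := (abs_le.1 h3).1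
  nlinarith [mul_nonneg (norm_nonneg (G x y)) (sq_nonneg (‖a x‖ - ‖b y‖))]

lemma unit_form {κ : Type*} [Fintype κ] [DecidableEq κ] {W : Matrix κ κ ℂ} (h : W * Wᴴ = 1)
    (a b : κ → ℂ) :
    2 * (∑ x, ∑ y, (starRingEnd ℂ) (a x) * ((-(Real.sqrt 2) : ℂ) • W) x y * b y).re =
      Real.sqrt 2 * (∑ x, ‖a x - (W *ᵥ b) x‖ ^ 2 - ∑ x, ‖a x‖ ^ 2 - ∑ x, ‖b x‖ ^ 2) := by
  rw [← unit_isom h b, ← Finset.sum_sub_distrib, ← Finset.sum_sub_distrib, Complex.re_sum,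
    Finset.mul_sum, Finset.mul_sum]
  refine Finset.sum_congr rfl fun x _ => ?_
  have : ∑ y, (starRingEnd ℂ) (a x) * ((-(Real.sqrt 2) : ℂ) • W) x y * b y =
      ((-Real.sqrt 2 : ℝ) : ℂ) * ((starRingEnd ℂ) (a x) * (W *ᵥ b) x) := by
    simp only [Matrix.mulVec, dotProduct, Finset.mul_sum, Matrix.smul_apply, smul_eq_mul]
    refine Finset.sum_congr rfl fun y _ => ?_
    push_cast; ring
  rw [this, Complex.re_ofReal_mul]
  generalize (W *ᵥ b) x = z
  simp only [← Complex.normSq_eq_norm_sq, Complex.normSq_apply, Complex.mul_re, Complex.sub_re,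
    Complex.sub_im, Complex.conj_re, Complex.conj_im]
  ring

lemma cyc_bij (m : ℕ) : Function.Bijective (cycSucc : Fin m → Fin m) := by
  rw [← Finite.injective_iff_bijective]
  intro a b hab
  have h := congrArg Fin.val hab
  simp only [cycSucc] at h
  have ha := a.2
  have hb := b.2
  have h3 : ∀ c : Fin m, ((c : ℕ) + 1) % m = if (c : ℕ) + 1 = m then 0 else (c : ℕ) + 1 := by
    intro c
    split_ifs with hc
    · rw [hc, Nat.mod_self]
    · exact Nat.mod_eq_of_lt (by have := c.2; omega)
  rw [h3, h3] at h
  apply Fin.ext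
  split_ifs at h <;> omega

lemma cyc_sum {m : ℕ} (f : Fin m → ℝ) : ∑ s, f (cycSucc s) = ∑ s, f s :=
  (cyc_bij m).sum_comp f

noncomputable def nrm {κ : Type*} [Fintype κ] (f : κ → ℂ) : ℝ :=
  ‖(WithLp.toLp 2 f : EuclideanSpace ℂ κ)‖

lemma nrm_sq {κ : Type*} [Fintype κ] (f : κ → ℂ) : nrm f ^ 2 = ∑ x, ‖f x‖ ^ 2 := by
  unfold nrm; rw [EuclideanSpace.norm_sq_eq]

lemma nrm_nonneg {κ : Type*} [Fintype κ] (f : κ → ℂ) : 0 ≤ nrm f := norm_nonneg _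

lemma nrm_add {κ : Type*} [Fintype κ] (f g : κ → ℂ) : nrm (f + g) ≤ nrm f + nrm g := by
  unfold nrm; rw [WithLp.toLp_add]; exact norm_add_le _ _

lemma nrm_mono {κ : Type*} [Fintype κ] {f g : κ → ℂ} (h : ∀ x, ‖f x‖ ≤ ‖g x‖) : nrm f ≤ nrm g := by
  rw [← abs_of_nonneg (nrm_nonneg f), ← abs_of_nonneg (nrm_nonneg g), ← sq_le_sq, nrm_sq, nrm_sq]
  exact Finset.sum_le_sum fun x _ => pow_le_pow_left₀ (norm_nonneg _) (h x) 2

lemma nrm_unit {κ : Type*} [Fintype κ] [DecidableEq κ] {W : Matrix κ κ ℂ} (h : W * Wᴴ = 1)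
    (f : κ → ℂ) : nrm (W *ᵥ f) = nrm f := by
  rw [← abs_of_nonneg (nrm_nonneg f), ← abs_of_nonneg (nrm_nonneg (W *ᵥ f)), ← sq_eq_sq_iff_abs_eq_abs,
    nrm_sq, nrm_sq]
  exact unit_isom h f

/-! ### the path estimate -/

noncomputable def pref (n M : ℕ) (U : ℕ → Matrix (QState n) (QState n) ℂ) : ℕ →
    Matrix (QState n) (QState n) ℂ
  | 0 => 1
  | t + 1 => Wseq n M U t * pref n M U t

lemma pref_unit {n M : ℕ} {U : ℕ → Matrix (QState n) (QState n) ℂ}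
    (hU : ∀ i, i < M → AllowedGate n (U i)) (t : ℕ) (ht : t ≤ 2 * M) :
    pref n M U t * (pref n M U t)ᴴ = 1 := by
  induction t with
  | zero => simp [pref]
  | succ t ih =>
    have h1 := W_unit hU (t := t) (by omega)
    simp only [pref, Matrix.conjTranspose_mul]
    rw [Matrix.mul_assoc, ← Matrix.mul_assoc (pref n M U t), ih (by omega), Matrix.one_mul, h1]

lemma pref_circuit {n M : ℕ} {U : ℕ → Matrix (QState n) (QState n) ℂ} (t : ℕ) (ht : t ≤ M) :
    pref n M U t = ((List.range t).reverse.map U).prod := by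
  induction t with
  | zero => simp [pref]
  | succ t ih =>
    rw [List.range_succ, List.reverse_append, List.map_append, List.prod_append, ← ih (by omega)]
    simp [pref, Wseq, show t < M by omega]

lemma path_bound {n M : ℕ} {U : ℕ → Matrix (QState n) (QState n) ℂ}
    (hU : ∀ i, i < M → AllowedGate n (U i)) (φ : Fin (2 * M) → QState n → ℂ) (h0 : 0 < 2 * M)
    (D : ℕ → ℝ) (hD : ∀ s : Fin (2 * M), D s = nrm (φ (cycSucc s) - Wseq n M U s *ᵥ φ s))
    (t : ℕ) (ht : t < 2 * M) :
    nrm (φ ⟨t, ht⟩ - pref n M U t *ᵥ φ ⟨0, h0⟩) ≤ ∑ s ∈ Finset.range t, D s := by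
  induction t with
  | zero => simp [pref, nrm]
  | succ t ih =>
    have ht' : t < 2 * M := by omega
    rw [Finset.sum_range_succ]
    have e : φ ⟨t + 1, ht⟩ - pref n M U (t + 1) *ᵥ φ ⟨0, h0⟩ =
        Wseq n M U t *ᵥ (φ ⟨t, ht'⟩ - pref n M U t *ᵥ φ ⟨0, h0⟩) +
          (φ (cycSucc ⟨t, ht'⟩) - Wseq n M U t *ᵥ φ ⟨t, ht'⟩) := by
      have : cycSucc (⟨t, ht'⟩ : Fin (2 * M)) = ⟨t + 1, ht⟩ := by
        apply Fin.ext; simp only [cycSucc]; exact Nat.mod_eq_of_lt ht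
      rw [this, Matrix.mulVec_sub, pref, Matrix.mulVec_mulVec]
      abel
    rw [e]
    refine (nrm_add _ _).trans (add_le_add ?_ ?_)
    · rw [nrm_unit (W_unit hU ht')]; exact ih ht'
    · exact (hD ⟨t, ht'⟩).symm.le

lemma path_sq {n M : ℕ} {U : ℕ → Matrix (QState n) (QState n) ℂ}
    (hU : ∀ i, i < M → AllowedGate n (U i)) (φ : Fin (2 * M) → QState n → ℂ) (h0 : 0 < 2 * M)
    (t : ℕ) (ht : t < 2 * M) :
    nrm (φ ⟨t, ht⟩ - pref n M U t *ᵥ φ ⟨0, h0⟩) ^ 2 ≤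
      t * ∑ s : Fin (2 * M), nrm (φ (cycSucc s) - Wseq n M U s *ᵥ φ s) ^ 2 := by
  let D : ℕ → ℝ := fun s => if h : s < 2 * M then
    nrm (φ (cycSucc ⟨s, h⟩) - Wseq n M U s *ᵥ φ ⟨s, h⟩) else 0
  have hD : ∀ s : Fin (2 * M), D s = nrm (φ (cycSucc s) - Wseq n M U s *ᵥ φ s) := by
    intro s; simp [D]
  have h1 := path_bound hU φ h0 D hD t ht
  calc _ ≤ (∑ s ∈ Finset.range t, D s) ^ 2 := pow_le_pow_left₀ (nrm_nonneg _) h1 2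
    _ ≤ t * ∑ s ∈ Finset.range t, D s ^ 2 := by
      have := sq_sum_le_card_mul_sum_sq (s := Finset.range t) (f := D)
      simpa using this
    _ ≤ t * ∑ s ∈ Finset.range (2 * M), D s ^ 2 := by
      gcongr
    _ = _ := by
      rw [Finset.sum_range]
      simp only [hD]
/-! ### soundness and the core estimate -/

/-- ancilla-zero part -/
noncomputable def anc0 {n : ℕ} (nin : ℕ) (a : QState n → ℂ) : QState n → ℂ :=
  fun x => if ∀ j : Fin n, nin ≤ (j : ℕ) → x j = 0 then a x else 0

noncomputable def anc1 {n : ℕ} (nin : ℕ) (a : QState n → ℂ) : QState n → ℂ :=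
  fun x => if ∀ j : Fin n, nin ≤ (j : ℕ) → x j = 0 then 0 else a x

noncomputable def pr {n : ℕ} (out : Fin n) (a : QState n → ℂ) : QState n → ℂ :=
  fun x => if x out = 0 then a x else 0

def ext0 {n nin : ℕ} (z : QState nin) : QState n :=
  fun j => if h : (j : ℕ) < nin then z ⟨j, h⟩ else 0

lemma embed_anc {n nin : ℕ} (h : nin ≤ n) (a : QState n → ℂ) :
    embedInput n nin h (fun z => a (ext0 z)) = anc0 nin a := by
  funext x
  simp only [embedInput, anc0]
  split_ifs with hx
  · rw [one_mul]
    congr 1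
    funext j
    simp only [ext0]
    split_ifs with hj
    · rfl
    · exact (hx j (by omega)).symm
  · simp

lemma ext_sum {n nin : ℕ} (h : nin ≤ n) (a : QState n → ℂ) :
    ∑ z : QState nin, ‖a (ext0 z)‖ ^ 2 ≤ nrm (anc0 nin a) ^ 2 := by
  rw [nrm_sq]
  have hinj : Function.Injective (ext0 : QState nin → QState n) := by
    intro z z' hz
    funext i
    have := congrFun hz (Fin.castLE h i)
    simpa [ext0] using this
  have e : ∀ z : QState nin, ‖a (ext0 z)‖ ^ 2 = ‖anc0 nin a (ext0 z)‖ ^ 2 := by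
    intro z
    simp only [anc0]
    rw [if_pos]
    intro j hj
    simp [ext0, hj]
  simp only [e]
  rw [← Finset.sum_image (f := fun x => ‖anc0 nin a x‖ ^ 2) (s := Finset.univ)
    (g := (ext0 : QState nin → QState n)) (fun _ _ _ _ hh => hinj hh)]
  exact Finset.sum_le_sum_of_subset_of_nonneg (Finset.subset_univ _) (fun _ _ _ => by positivity)

lemma sound_scaled {n M nin : ℕ} (hninn : nin ≤ n) (out : Fin n)
    (U : ℕ → Matrix (QState n) (QState n) ℂ)
    (hsound : ∀ ψ : QState nin → ℂ, dotProduct (star ψ) ψ = 1 →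
      acceptProb n M nin hninn out U ψ ≤ 1 / 3) (ψ : QState nin → ℂ) :
    acceptProb n M nin hninn out U ψ ≤ 1 / 3 * ∑ z, ‖ψ z‖ ^ 2 := by
  have hc : ∀ g : QState nin → ℂ, star g ⬝ᵥ g = ((∑ x, ‖g x‖ ^ 2 : ℝ) : ℂ) := by
    intro g
    simp only [dotProduct, Pi.star_apply, RCLike.star_def]
    rw [Complex.ofReal_sum]
    refine Finset.sum_congr rfl fun x _ => ?_
    rw [← Complex.normSq_eq_conj_mul_self, Complex.normSq_eq_norm_sq]
  have hs : ∀ (c : ℝ), acceptProb n M nin hninn out U ((c : ℂ) • ψ) =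
      c ^ 2 * acceptProb n M nin hninn out U ψ := by
    intro c
    have : embedInput n nin hninn ((c : ℂ) • ψ) = (c : ℂ) • embedInput n nin hninn ψ := by
      funext x; simp only [embedInput, Pi.smul_apply, smul_eq_mul]; ring
    simp only [acceptProb, this, Matrix.mulVec_smul, Finset.mul_sum]
    refine Finset.sum_congr rfl fun x _ => ?_
    split_ifs
    · rw [Pi.smul_apply, smul_eq_mul, Complex.normSq_mul, Complex.normSq_ofReal]; ring
    · simp
  set N := ∑ z, ‖ψ z‖ ^ 2 with hN
  have hN0 : 0 ≤ N := Finset.sum_nonneg fun _ _ => by positivity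
  rcases hN0.eq_or_lt with h0 | h0
  · have hz : ψ = 0 := by
      funext z
      have := (Finset.sum_eq_zero_iff_of_nonneg (fun z _ => by positivity)).1 (hN.symm.trans h0.symm) z
        (Finset.mem_univ _)
      simpa using this
    have h1 := hs 0
    simp only [Complex.ofReal_zero, zero_smul] at h1
    rw [hz, h1, ← h0]; norm_num
  · have h1 := hsound (((Real.sqrt N)⁻¹ : ℝ) • ψ |> fun f => (((Real.sqrt N)⁻¹ : ℝ) : ℂ) • ψ) (by
      rw [hc]
      simp only [Pi.smul_apply, smul_eq_mul, norm_mul, mul_pow, ← Finset.mul_sum, ← hN]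
      rw [Complex.norm_real, Real.norm_eq_abs, sq_abs, inv_pow, Real.sq_sqrt hN0,
        inv_mul_cancel₀ h0.ne']
      simp)
    rw [hs, inv_pow, Real.sq_sqrt hN0, inv_mul_le_iff₀ h0] at h1
    linarith

lemma sound_pr {n M nin : ℕ} (hninn : nin ≤ n) (out : Fin n)
    (U : ℕ → Matrix (QState n) (QState n) ℂ)
    (hU : ∀ i, i < M → AllowedGate n (U i))
    (hsound : ∀ ψ : QState nin → ℂ, dotProduct (star ψ) ψ = 1 →
      acceptProb n M nin hninn out U ψ ≤ 1 / 3) (a : QState n → ℂ) :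
    2 / 3 * nrm (anc0 nin a) ^ 2 ≤ nrm (pr out (pref n M U M *ᵥ anc0 nin a)) ^ 2 := by
  have h1 := sound_scaled hninn out U hsound (fun z => a (ext0 z))
  have h2 := ext_sum hninn a
  have hu : pref n M U M * (pref n M U M)ᴴ = 1 := pref_unit hU M (by omega)
  have h3 : nrm (pref n M U M *ᵥ anc0 nin a) ^ 2 = nrm (anc0 nin a) ^ 2 := by rw [nrm_unit hu]
  have h4 : nrm (pref n M U M *ᵥ anc0 nin a) ^ 2 = nrm (pr out (pref n M U M *ᵥ anc0 nin a)) ^ 2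
      + acceptProb n M nin hninn out U (fun z => a (ext0 z)) := by
    rw [nrm_sq, nrm_sq, acceptProb, embed_anc, ← Finset.sum_add_distrib, circuitU,
      ← pref_circuit M le_rfl]
    refine Finset.sum_congr rfl fun x _ => ?_
    simp only [pr]
    rcases (show x out = 0 ∨ x out = 1 by have := (x out).2; generalize x out = w; revert w; decide)
      with h | h
    · simp [h]
    · simp [h, Complex.normSq_eq_norm_sq]
  linarith

lemma dg_bound {n M nin : ℕ} (out : Fin n) (φ : Fin (2 * M) → QState n → ℂ) (h0 : 0 < 2 * M)
    (hMM : M < 2 * M) :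
    nrm (anc1 nin (φ ⟨0, h0⟩)) ^ 2 + nrm (pr out (φ ⟨M, hMM⟩)) ^ 2 ≤
      ∑ t, ∑ x, dg nin out x t * ‖φ t x‖ ^ 2 := by
  simp only [dg, add_mul, Finset.sum_add_distrib]
  refine add_le_add ?_ ?_
  · refine le_trans ?_ (Finset.single_le_sum (f := fun t : Fin (2 * M) => ∑ x, (if (t : ℕ) = 0 then
      ((Finset.univ.filter fun j : Fin n => nin ≤ (j : ℕ) ∧ x j = 1).card : ℝ) else 0)
        * ‖φ t x‖ ^ 2) (fun t _ => Finset.sum_nonneg fun x _ => ?_) (Finset.mem_univ ⟨0, h0⟩))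
    · rw [nrm_sq]
      refine Finset.sum_le_sum fun x _ => ?_
      simp only [anc1, if_true]
      split_ifs with hx
      · rw [norm_zero, zero_pow two_ne_zero]; exact mul_nonneg (Nat.cast_nonneg _) (sq_nonneg _)
      · push Not at hx
        obtain ⟨j, hj, hxj⟩ := hx
        have : x j = 1 := by
          generalize x j = w at *; revert w; decide
        have hc : 1 ≤ (Finset.univ.filter fun j : Fin n => nin ≤ (j : ℕ) ∧ x j = 1).card :=
          Finset.card_pos.2 ⟨j, by simp [hj, this]⟩
        have hc' : (1:ℝ) ≤ (Finset.univ.filter fun j : Fin n => nin ≤ (j : ℕ) ∧ x j = 1).card := by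
          exact_mod_cast hc
        nlinarith [sq_nonneg ‖φ ⟨0, h0⟩ x‖]
    · split_ifs <;> positivity
  · refine le_trans ?_ (Finset.single_le_sum (f := fun t : Fin (2 * M) => ∑ x,
      (if x out = 0 ∧ (t : ℕ) = M then (1:ℝ) else 0)
        * ‖φ t x‖ ^ 2) (fun t _ => Finset.sum_nonneg fun x _ => ?_) (Finset.mem_univ ⟨M, hMM⟩))
    · rw [nrm_sq]
      refine Finset.sum_le_sum fun x _ => ?_
      simp only [pr, and_true]
      split_ifs <;> simp
    · split_ifs <;> positivity

lemma arith_tri {r R A Z K : ℝ} (hr : 0 ≤ r) (h : r ≤ R + (A + Z)) (h1 : R ^ 2 ≤ 2 * K)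
    (h2 : A ^ 2 ≤ 9 / 2 * K) (h3 : Z ^ 2 ≤ K) : r ^ 2 ≤ 45 / 2 * K := by
  have h4 : r ^ 2 ≤ (R + (A + Z)) ^ 2 := pow_le_pow_left₀ hr h 2
  linarith [sq_nonneg (R - A), sq_nonneg (A - Z), sq_nonneg (R - Z)]

lemma nrm_tri {n : ℕ} {P : Matrix (QState n) (QState n) ℂ} (hP : P * Pᴴ = 1)
    (f a : QState n → ℂ) : nrm f ≤ nrm (f - P *ᵥ a) + nrm a := by
  have h := nrm_add (f - P *ᵥ a) (P *ᵥ a)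
  rw [sub_add_cancel, nrm_unit hP] at h
  exact h

set_option maxHeartbeats 1000000 in
lemma core {n M nin : ℕ} (hM : 1 ≤ M) (hninn : nin ≤ n) (out : Fin n)
    (U : ℕ → Matrix (QState n) (QState n) ℂ)
    (hU : ∀ i, i < M → AllowedGate n (U i))
    (hsound : ∀ ψ : QState nin → ℂ, dotProduct (star ψ) ψ = 1 →
      acceptProb n M nin hninn out U ψ ≤ 1 / 3) (φ : Fin (2 * M) → QState n → ℂ) :
    ∑ t, ∑ x, ‖φ t x‖ ^ 2 ≤ 45 * (M : ℝ) ^ 2 *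
      (Real.sqrt 2 * ∑ s : Fin (2 * M), ∑ x, ‖φ (cycSucc s) x - (Wseq n M U s *ᵥ φ s) x‖ ^ 2 +
        ∑ t, ∑ x, dg nin out x t * ‖φ t x‖ ^ 2) := by
  have h0 : 0 < 2 * M := by omega
  have hMM : M < 2 * M := by omega
  have hd := dg_bound (nin := nin) out φ h0 hMM
  set Q := ∑ t, ∑ x, dg nin out x t * ‖φ t x‖ ^ 2
  have hpath := path_sq hU φ h0
  set δ := ∑ s : Fin (2 * M), nrm (φ (cycSucc s) - Wseq n M U s *ᵥ φ s) ^ 2 with hδ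
  have hδ' : ∑ s : Fin (2 * M), ∑ x, ‖φ (cycSucc s) x - (Wseq n M U s *ᵥ φ s) x‖ ^ 2 = δ := by
    rw [hδ]
    refine Finset.sum_congr rfl fun s _ => ?_
    rw [nrm_sq]; rfl
  rw [hδ']
  have hδ0 : 0 ≤ δ := Finset.sum_nonneg fun _ _ => by positivity
  set a := φ ⟨0, h0⟩
  set b := φ ⟨M, hMM⟩
  have hM1 : (1:ℝ) ≤ M := by exact_mod_cast hM
  have hs2 : 1 ≤ Real.sqrt 2 := by
    rw [Real.one_le_sqrt]; norm_num
  set E := Real.sqrt 2 * δ + Q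
  have ha : a = anc0 nin a + anc1 nin a := by
    funext x
    simp only [anc0, anc1, Pi.add_apply]
    split_ifs <;> simp
  have hs := sound_pr hninn out U hU hsound a
  have hy := hpath M hMM
  have hprM := pref_unit hU M (by omega)
  set P := pref n M U M
  have prle : ∀ f : QState n → ℂ, nrm (pr out f) ≤ nrm f := by
    intro f
    apply nrm_mono
    intro x
    simp only [pr]
    split_ifs <;> simp
  have nneg : ∀ f : QState n → ℂ, nrm (-f) = nrm f := by
    intro f; unfold nrm; rw [WithLp.toLp_neg, norm_neg]
  have htri : nrm (pr out (P *ᵥ anc0 nin a)) ≤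
      nrm (pr out b) + nrm (b - P *ᵥ a) + nrm (anc1 nin a) := by
    have e : pr out (P *ᵥ anc0 nin a) =
        pr out b + pr out (-(b - P *ᵥ a)) + pr out (-(P *ᵥ anc1 nin a)) := by
      have hPa : P *ᵥ a = P *ᵥ anc0 nin a + P *ᵥ anc1 nin a := by
        rw [← Matrix.mulVec_add, ← ha]
      funext x
      have := congrFun hPa x
      simp only [Pi.add_apply] at this
      simp only [pr, Pi.add_apply, Pi.neg_apply, Pi.sub_apply]
      split_ifs
      · rw [this]; ring
      · simp
    rw [e]
    refine (nrm_add _ _).trans (add_le_add ((nrm_add _ _).trans (add_le_add le_rfl ?_)) ?_)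
    · exact (prle _).trans (nneg _).le
    · refine (prle _).trans ?_
      rw [nneg, nrm_unit hprM]
  set X := nrm (pr out b)
  set Y := nrm (b - P *ᵥ a)
  set Z := nrm (anc1 nin a)
  set A0 := nrm (anc0 nin a)
  have hA0 : A0 ^ 2 ≤ 9 / 2 * (X ^ 2 + Y ^ 2 + Z ^ 2) := by
    have h1 : nrm (pr out (P *ᵥ anc0 nin a)) ^ 2 ≤ (X + Y + Z) ^ 2 :=
      pow_le_pow_left₀ (nrm_nonneg _) htri 2
    nlinarith [sq_nonneg (X - Y), sq_nonneg (Y - Z), sq_nonneg (X - Z)]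
  have hQ0 : 0 ≤ Q := le_trans (by positivity) hd
  have hE : δ + Q ≤ E := by
    have : δ ≤ Real.sqrt 2 * δ := by nlinarith
    linarith
  have hE0 : 0 ≤ E := by linarith
  have hA1 : A0 ^ 2 ≤ 9 / 2 * (M * E) := by
    have : X ^ 2 + Z ^ 2 ≤ M * Q := by nlinarith
    have h2 : M * (δ + Q) ≤ M * E := by gcongr
    nlinarith
  have hZ : Z ^ 2 ≤ M * E := by nlinarith [sq_nonneg X]
  have ht : ∀ t : Fin (2 * M), ∑ x, ‖φ t x‖ ^ 2 ≤ 45 / 2 * (M * E) := by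
    intro t
    rw [← nrm_sq]
    have hp : nrm (φ t - pref n M U t *ᵥ a) ^ 2 ≤ (t : ℕ) * δ := hpath t t.2
    have hpu := pref_unit hU (t : ℕ) (by omega)
    have h2 : nrm a ≤ A0 + Z := by
      have h := nrm_add (anc0 nin a) (anc1 nin a)
      rw [← ha] at h
      exact h
    have h1 := nrm_tri hpu (φ t) a
    have h4 : ((t : ℕ) : ℝ) ≤ 2 * M := by exact_mod_cast t.2.le
    have h5 : nrm (φ t - pref n M U t *ᵥ a) ^ 2 ≤ 2 * (M * E) := by
      have h7 : ((t : ℕ) : ℝ) * δ ≤ 2 * M * δ := mul_le_mul_of_nonneg_right h4 hδ0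
      have h6 : M * δ ≤ M * E := mul_le_mul_of_nonneg_left (by linarith) (by linarith)
      linarith
    exact arith_tri (nrm_nonneg _) (h1.trans (add_le_add le_rfl h2)) h5 hA1 hZ
  calc ∑ t, ∑ x, ‖φ t x‖ ^ 2 ≤ ∑ t : Fin (2 * M), 45 / 2 * (M * E) :=
        Finset.sum_le_sum fun t _ => ht t
    _ = 45 * (M : ℝ) ^ 2 * E := by
      simp; ring

lemma sec_ne {n M : ℕ} {v : CVertex n M → ℂ} (hv : v ≠ 0) :
    ∃ k : Fin 8, sec (omega ^ (k : ℕ)) v ≠ 0 := by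
  by_contra hcon
  push Not at hcon
  apply hv
  funext ⟨x, t, j⟩
  have hdet : (Matrix.vandermonde (fun k : Fin 8 => omega ^ (k : ℕ))).det ≠ 0 := by
    rw [Matrix.det_vandermonde_ne_zero_iff]
    intro a b h; exact omega_fin_inj h
  have := Matrix.eq_zero_of_mulVec_eq_zero hdet (v := fun j => v (x, t, j)) (by
    funext k
    have := congrFun (congrFun (hcon k) x) t
    simpa [sec, Matrix.mulVec, dotProduct, Matrix.vandermonde_apply] using this)
  exact congrFun this j

end QCP


/-- Suppose that
`AP(ψ) = ‖ (|1⟩⟨1|)_out · U_C (ψ ⊗ |0⟩^{⊗(n−n_in)}) ‖² ≤ 1/3` for every unit vector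
`ψ ∈ (ℂ²)^{⊗n_in}`.  Then every eigenvalue of `A_x` is at least
`e₁ + 1/(120 M⁴ n)`, where `e₁ = −1 − 3√2`.  (Being a symmetric real matrix, `A_x` has
real spectrum.) -/
theorem ax_no_instance_bound
    (n M nin : ℕ) (hn : 1 ≤ n) (hM : 1 ≤ M)
    (hnin1 : 1 ≤ nin) (hninn : nin ≤ n) (out : Fin n)
    (U : ℕ → Matrix (QState n) (QState n) ℂ)
    (hU : ∀ i, i < M → AllowedGate n (U i))
    (hsound : ∀ ψ : QState nin → ℂ, dotProduct (star ψ) ψ = 1 →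
      acceptProb n M nin hninn out U ψ ≤ 1 / 3) :
    ∀ μ : ℝ, Module.End.HasEigenvalue (Ax n M nin out U).mulVecLin ((μ : ℝ) : ℂ) →
      e1 + 1 / (120 * (M : ℝ) ^ 4 * n) ≤ μ := by
  intro μ hμ
  obtain ⟨v, hv⟩ := hμ.exists_hasEigenvector
  have hv1 : Ax n M nin out U *ᵥ v = (μ : ℂ) • v := hv.apply_eq_smul
  obtain ⟨k, hk⟩ := QCP.sec_ne hv.2
  have hχ : (omega ^ (k : ℕ)) ^ 8 = 1 := by rw [← pow_mul, mul_comm, pow_mul, QCP.omega_pow8, one_pow]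
  have hq := QCP.sector_quad hχ U v μ hv1
  have hM1 : (1:ℝ) ≤ M := by exact_mod_cast hM
  have hn1 : (1:ℝ) ≤ n := by exact_mod_cast hn
  have hM4 : (1:ℝ) ≤ (M:ℝ) ^ 4 := one_le_pow₀ hM1
  have hM2 : (1:ℝ) ≤ (M:ℝ) ^ 2 := one_le_pow₀ hM1
  have hM24 : (M:ℝ) ^ 2 ≤ (M:ℝ) ^ 4 := pow_le_pow_right₀ hM1 (by norm_num)
  have hM4n : (M:ℝ) ^ 4 ≤ (M:ℝ) ^ 4 * n := by nlinarith
  set N := ∑ t, ∑ x, ‖QCP.sec (omega ^ (k : ℕ)) v x t‖ ^ 2 with hN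
  have hNpos : 0 < N := by
    obtain ⟨x, hx⟩ := Function.ne_iff.1 hk
    obtain ⟨t, ht⟩ := Function.ne_iff.1 hx
    have hp : 0 < ‖QCP.sec (omega ^ (k : ℕ)) v x t‖ ^ 2 := by
      have : 0 < ‖QCP.sec (omega ^ (k : ℕ)) v x t‖ := norm_pos_iff.2 ht
      positivity
    refine Finset.sum_pos' (fun t _ => Finset.sum_nonneg fun x _ => by positivity)
      ⟨t, Finset.mem_univ _, Finset.sum_pos' (fun x _ => by positivity) ⟨x, Finset.mem_univ _, hp⟩⟩
  have hcyc : ∑ s : Fin (2 * M), ∑ x, ‖QCP.sec (omega ^ (k : ℕ)) v x (cycSucc s)‖ ^ 2 = N :=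
    QCP.cyc_sum (fun s => ∑ x, ‖QCP.sec (omega ^ (k : ℕ)) v x s‖ ^ 2)
  by_cases hk17 : k = 1 ∨ k = 7
  · -- the two good sectors
    have hmain : ∃ φ : Fin (2 * M) → QState n → ℂ,
        (∀ t x, ‖φ t x‖ = ‖QCP.sec (omega ^ (k : ℕ)) v x t‖) ∧
        (∀ s : Fin (2 * M), (∑ x, ∑ y, (starRingEnd ℂ) (QCP.sec (omega ^ (k : ℕ)) v x (cycSucc s)) *
        QCP.Gh (omega ^ (k : ℕ)) ((-(Real.sqrt 2) : ℂ) • Wseq n M U (s : ℕ)) x y *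
          QCP.sec (omega ^ (k : ℕ)) v y s).re = (∑ x, ∑ y, (starRingEnd ℂ) (φ (cycSucc s) x) *
          ((-(Real.sqrt 2) : ℂ) • Wseq n M U (s : ℕ)) x y * φ s y).re) ∧
        ((omega ^ (k : ℕ)) ^ 3 + (omega ^ (k : ℕ)) ^ 4 + (omega ^ (k : ℕ)) ^ 5).re
          = -1 - Real.sqrt 2 := by
      rcases hk17 with rfl | rfl
      · have e : omega ^ ((1 : Fin 8) : ℕ) = omega := by simp
        rw [e]
        refine ⟨fun t x => QCP.sec omega v x t, fun _ _ => rfl, fun s => ?_, QCP.pen_re_one⟩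
        simp only [QCP.Gh_one (QCP.W_entry hU s.2)]
      · have e : omega ^ ((7 : Fin 8) : ℕ) = omega ^ 7 := by rfl
        rw [e]
        refine ⟨fun t x => (starRingEnd ℂ) (QCP.sec (omega ^ 7) v x t),
          fun _ _ => Complex.norm_conj _, fun s => ?_, QCP.pen_re_seven⟩
        simp only [QCP.Gh_seven (QCP.W_entry hU s.2)]
        rw [← Complex.conj_re]
        simp only [map_sum, map_mul, Complex.conj_conj]
    obtain ⟨φ, hφ1, hφ2, hpen⟩ := hmain
    simp only [hφ2, hpen] at hq
    simp only [← hφ1] at hq hcyc hN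
    have hcore := QCP.core hM hninn out U hU hsound φ
    rw [← hN] at hcore
    set Q := ∑ t, ∑ x, QCP.dg nin out x t * ‖φ t x‖ ^ 2
    set δ := ∑ s : Fin (2 * M), ∑ x, ‖φ (cycSucc s) x - (Wseq n M U s *ᵥ φ s) x‖ ^ 2
    have hp2 : 2 * ∑ s : Fin (2 * M), (∑ x, ∑ y, (starRingEnd ℂ) (φ (cycSucc s) x) *
        ((-(Real.sqrt 2) : ℂ) • Wseq n M U (s : ℕ)) x y * φ s y).re
        = Real.sqrt 2 * (δ - N - N) := by
      rw [Finset.mul_sum, Finset.sum_congr rfl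
        (fun s _ => QCP.unit_form (QCP.W_unit hU s.2) (φ (cycSucc s)) (φ s)),
        ← Finset.mul_sum, Finset.sum_sub_distrib, Finset.sum_sub_distrib, hcyc, ← hN]
    rw [hp2] at hq
    have hE : (μ - e1) * N = Real.sqrt 2 * δ + Q := by
      unfold e1; linarith
    rw [← hE] at hcore
    have h45 : 1 ≤ 45 * (M:ℝ) ^ 2 * (μ - e1) := by
      by_contra hcon
      push Not at hcon
      nlinarith
    have hpos : 0 < μ - e1 := by
      by_contra hcon
      push Not at hcon
      nlinarith
    have : 1 / (120 * (M : ℝ) ^ 4 * n) ≤ μ - e1 := by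
      rw [div_le_iff₀ (by positivity)]
      nlinarith
    linarith
  · push Not at hk17
    have hpen := QCP.pen_re k hk17.1 hk17.2
    have hdg : 0 ≤ ∑ t, ∑ x, QCP.dg nin out x t * ‖QCP.sec (omega ^ (k : ℕ)) v x t‖ ^ 2 := by
      refine Finset.sum_nonneg fun t _ => Finset.sum_nonneg fun x _ => ?_
      unfold QCP.dg
      refine mul_nonneg (add_nonneg ?_ ?_) (by positivity) <;> split_ifs <;> positivity
    have hsm : ∀ z : ℂ, ‖(-(Real.sqrt 2) : ℂ) * z‖ ^ 2 = 2 * ‖z‖ ^ 2 := by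
      intro z
      rw [norm_mul, mul_pow, norm_neg, Complex.norm_real, Real.norm_eq_abs, sq_abs,
        Real.sq_sqrt (by norm_num)]
    have hprop : -(4 * N) ≤ 2 * ∑ s : Fin (2 * M), (∑ x, ∑ y,
        (starRingEnd ℂ) (QCP.sec (omega ^ (k : ℕ)) v x (cycSucc s)) *
        QCP.Gh (omega ^ (k : ℕ)) ((-(Real.sqrt 2) : ℂ) • Wseq n M U (s : ℕ)) x y *
          QCP.sec (omega ^ (k : ℕ)) v y s).re := by
      have h1 : -(4 * N) = ∑ s : Fin (2 * M),
          -(2 * ∑ x, ‖QCP.sec (omega ^ (k : ℕ)) v x (cycSucc s)‖ ^ 2 +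
            2 * ∑ x, ‖QCP.sec (omega ^ (k : ℕ)) v x s‖ ^ 2) := by
        rw [Finset.sum_neg_distrib, Finset.sum_add_distrib, ← Finset.mul_sum, ← Finset.mul_sum,
          hcyc, ← hN]
        ring
      rw [h1, Finset.mul_sum]
      refine Finset.sum_le_sum fun s _ => ?_
      refine QCP.schur (fun x => ?_) (fun y => ?_)
        (fun x => QCP.sec (omega ^ (k : ℕ)) v x (cycSucc s))
        (fun x => QCP.sec (omega ^ (k : ℕ)) v x s)
      · simp only [QCP.Gh_norm hχ (QCP.W_entry hU s.2), Matrix.smul_apply, smul_eq_mul, hsm,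
          ← Finset.mul_sum, QCP.unit_row (QCP.W_unit hU s.2)]
        norm_num
      · simp only [QCP.Gh_norm hχ (QCP.W_entry hU s.2), Matrix.smul_apply, smul_eq_mul, hsm,
          ← Finset.mul_sum, QCP.unit_col (QCP.W_unit hU s.2)]
        norm_num
    have h5 : -5 ≤ μ := by
      by_contra hcon
      push Not at hcon
      nlinarith
    have h6 : 1 / (120 * (M : ℝ) ^ 4 * n) ≤ 1 / 120 := by
      apply one_div_le_one_div_of_le (by norm_num)
      nlinarith
    have h7 : (1.41:ℝ) ≤ Real.sqrt 2 := by
      apply Real.le_sqrt_of_sq_le; norm_num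
    unfold e1
    norm_num at h6 h7 ⊢
    linarith
end

section
/- The eigenspace of H_prop + H_penalty with eigenvalue e₁ = −1 − 3√2 has dimension 2^{n+1} and admits the orthonormal basis consisting of the vectors (1/√(2M)) Σ_{t=1}^{2M} (W_{t−1}W_{t−2}⋯W₁ φ) ⊗ |t⟩ ⊗ |ω⟩ together with the vectors (1/√(2M)) Σ_{t=1}^{2M} ((W_{t−1}W_{t−2}⋯W₁)^* φ) ⊗ |t⟩ ⊗ |ω*⟩, where φ ranges over the 2^n computational basis vectors of (ℂ²)^{⊗n}, the empty product (for t = 1) is the identity, * denotes entrywise complex conjugation in the computational basis, |ω⟩ = (1/√8)Σ_{j=0}^{7} ω^{−j}|j⟩, and |ω*⟩ = (1/√8)Σ_{j=0}^{7} ω^{j}|j⟩. -/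
open scoped Matrix

namespace QC

/-- The partial product `W_{t−1}W_{t−2}⋯W₁` (0-indexed: `W_{t−1}⋯W_0`, empty product for
the clock label `t = 1`). -/
noncomputable def Wpartial (n M : ℕ) (U : ℕ → Matrix (QState n) (QState n) ℂ) (t : ℕ) :
    Matrix (QState n) (QState n) ℂ :=
  ((List.range t).reverse.map (Wseq n M U)).prod

/-- The history state
`(1/√(2M)) Σ_{t=1}^{2M} (W_{t−1}W_{t−2}⋯W₁ φ) ⊗ |t⟩ ⊗ |ω⟩` for a computational basis
vector `φ`. -/
noncomputable def histVec (n M : ℕ) (U : ℕ → Matrix (QState n) (QState n) ℂ)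
    (φ : QState n) : CVertex n M → ℂ :=
  fun p => ((1 : ℝ) / Real.sqrt (2 * M) : ℝ)
    * Wpartial n M U (p.2.1 : ℕ) p.1 φ * omegaVec p.2.2

/-- The conjugated history state
`(1/√(2M)) Σ_{t=1}^{2M} ((W_{t−1}W_{t−2}⋯W₁)^* φ) ⊗ |t⟩ ⊗ |ω*⟩` for a computational
basis vector `φ`. -/
noncomputable def histVecConj (n M : ℕ) (U : ℕ → Matrix (QState n) (QState n) ℂ)
    (φ : QState n) : CVertex n M → ℂ :=
  fun p => ((1 : ℝ) / Real.sqrt (2 * M) : ℝ)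
    * starRingEnd ℂ (Wpartial n M U (p.2.1 : ℕ) p.1 φ) * omegaStarVec p.2.2

end QC

namespace QC

/-- Explicit value of `ω`. -/
lemma omega_eq : omega = ((Real.sqrt 2 / 2 : ℝ) : ℂ) * (1 + Complex.I) := by
  unfold omega
  have : (Real.pi * Complex.I / 4 : ℂ) = ((Real.pi / 4 : ℝ) : ℂ) * Complex.I := by
    push_cast; ring
  rw [this, Complex.exp_mul_I, ← Complex.ofReal_cos, ← Complex.ofReal_sin,
    Real.cos_pi_div_four, Real.sin_pi_div_four]
  ring

lemma sqrt2_sq : ((Real.sqrt 2 : ℝ) : ℂ) * ((Real.sqrt 2 : ℝ) : ℂ) = 2 := by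
  rw [← Complex.ofReal_mul, Real.mul_self_sqrt (by norm_num)]; norm_num

lemma omega_sq : omega ^ 2 = Complex.I := by
  rw [omega_eq]
  push_cast
  linear_combination (Complex.I / 2) * sqrt2_sq +
    (((Real.sqrt 2 : ℝ) : ℂ) * ((Real.sqrt 2 : ℝ) : ℂ) / 4) * Complex.I_sq

lemma omega_four : omega ^ 4 = -1 := by
  rw [show omega ^ 4 = (omega ^ 2) ^ 2 by ring, omega_sq, Complex.I_sq]

lemma omega_eight : omega ^ 8 = 1 := by
  rw [show omega ^ 8 = (omega ^ 4) ^ 2 by ring, omega_four]; norm_num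

lemma omega_prim : IsPrimitiveRoot omega 8 := by
  have := Complex.isPrimitiveRoot_exp 8 (by norm_num)
  convert this using 1
  unfold omega
  congr 1
  push_cast; ring

lemma omega_ne : omega ≠ 0 := Complex.exp_ne_zero _

lemma omega_norm : ‖omega‖ = 1 := by
  unfold omega
  have : (Real.pi * Complex.I / 4 : ℂ) = ((Real.pi / 4 : ℝ) : ℂ) * Complex.I := by
    push_cast; ring
  rw [this, Complex.norm_exp_ofReal_mul_I]

lemma omega_conj : starRingEnd ℂ omega = omega ^ 7 := by
  rw [← Complex.inv_eq_conj omega_norm]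
  field_simp [omega_ne]
  linear_combination -omega_eight

lemma omega_pow_congr {a b : ℕ} (h : a % 8 = b % 8) : omega ^ a = omega ^ b := by
  rw [← Nat.div_add_mod a 8, ← Nat.div_add_mod b 8, h]
  simp [pow_add, pow_mul, omega_eight]

/-- The character `ω^{kj}`. -/
noncomputable def chi (k j : Fin 8) : ℂ := omega ^ ((k : ℕ) * (j : ℕ))

lemma chi_add (k i j : Fin 8) : chi k (i + j) = chi k i * chi k j := by
  unfold chi
  rw [← pow_add]
  apply omega_pow_congr
  rw [Fin.val_add, ← mul_add, Nat.mul_mod, Nat.mod_mod, ← Nat.mul_mod]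

lemma chi_norm (k j : Fin 8) : ‖chi k j‖ = 1 := by
  simp [chi, omega_norm]

lemma chi_conj_mul (k j : Fin 8) : starRingEnd ℂ (chi k j) * chi k j = 1 := by
  rw [← Complex.normSq_eq_conj_mul_self, Complex.normSq_eq_norm_sq, chi_norm]; simp

lemma chi_symm (k j : Fin 8) : chi k j = chi j k := by
  unfold chi; rw [mul_comm]

lemma chi_orth (k l : Fin 8) :
    ∑ j, chi k j * starRingEnd ℂ (chi l j) = if k = l then 8 else 0 := by
  have h1 : ∀ j : Fin 8, chi k j * starRingEnd ℂ (chi l j)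
      = (omega ^ ((k : ℕ) + 7 * (l : ℕ))) ^ (j : ℕ) := by
    intro j
    simp only [chi, map_pow, omega_conj]
    rw [← pow_mul, ← pow_mul, ← pow_add]
    congr 1; ring
  simp_rw [h1]
  rw [Fin.sum_univ_eq_sum_range (fun j => (omega ^ ((k : ℕ) + 7 * (l : ℕ))) ^ j) 8]
  split_ifs with h
  · subst h
    have : omega ^ ((k : ℕ) + 7 * (k : ℕ)) = 1 := by
      rw [show (k : ℕ) + 7 * (k : ℕ) = 8 * k by ring, pow_mul, omega_eight, one_pow]
    simp [this]
  · have hne : omega ^ ((k : ℕ) + 7 * (l : ℕ)) ≠ 1 := by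
      rw [Ne, omega_prim.pow_eq_one_iff_dvd]
      intro hd
      apply h
      apply Fin.ext
      omega
    rw [geom_sum_eq hne, ← pow_mul, mul_comm _ 8, pow_mul, omega_eight]
    simp

lemma chi_orth' (i j : Fin 8) :
    ∑ k, chi k i * starRingEnd ℂ (chi k j) = if i = j then 8 else 0 := by
  rw [← chi_orth i j]
  exact Finset.sum_congr rfl fun k _ => by rw [chi_symm k i, chi_symm k j]

/-- The `k`-th Galois-type substitution on `0` and powers of `ω`. -/
noncomputable def ck (k : Fin 8) (z : ℂ) : ℂ :=
  ∑ d : Fin 8, if z = omega ^ (d : ℕ) then chi k d else 0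

lemma omega_pow_inj {a b : Fin 8} (h : omega ^ (a : ℕ) = omega ^ (b : ℕ)) : a = b :=
  Fin.ext (omega_prim.pow_inj a.2 b.2 h)

lemma ck_zero (k : Fin 8) : ck k 0 = 0 := by
  unfold ck
  apply Finset.sum_eq_zero
  intro d _
  rw [if_neg]
  exact fun h => pow_ne_zero _ omega_ne h.symm

lemma ck_pow (k d : Fin 8) : ck k (omega ^ (d : ℕ)) = chi k d := by
  unfold ck
  rw [Finset.sum_eq_single d]
  · simp
  · intro b _ hb
    rw [if_neg]
    exact fun h => hb (omega_pow_inj h).symm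
  · simp

/-- `0` or a power of `ω`. -/
def IsW (z : ℂ) : Prop := z = 0 ∨ ∃ d : Fin 8, z = omega ^ (d : ℕ)

lemma ck_one {z : ℂ} (hz : IsW z) : ck 1 z = z := by
  rcases hz with rfl | ⟨d, rfl⟩
  · exact ck_zero _
  · rw [ck_pow]; simp [chi]

lemma ck_seven {z : ℂ} (hz : IsW z) : ck 7 z = starRingEnd ℂ z := by
  rcases hz with rfl | ⟨d, rfl⟩
  · simp [ck_zero]
  · rw [ck_pow, map_pow, omega_conj, ← pow_mul]; rfl

lemma ck_norm (k : Fin 8) {z : ℂ} (hz : IsW z) : ‖ck k z‖ = ‖z‖ ^ 2 := by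
  rcases hz with rfl | ⟨d, rfl⟩
  · simp [ck_zero]
  · rw [ck_pow, chi_norm]; simp [omega_norm]

lemma IsW_pow (m : ℕ) : IsW (omega ^ m) :=
  Or.inr ⟨⟨m % 8, Nat.mod_lt _ (by norm_num)⟩, omega_pow_congr (by simp)⟩

lemma IsW_conj {z : ℂ} (hz : IsW z) : IsW (starRingEnd ℂ z) := by
  rcases hz with rfl | ⟨d, rfl⟩
  · left; simp
  · rw [map_pow, omega_conj, ← pow_mul]; exact IsW_pow _

/-- Penalty eigenvalue. -/
noncomputable def pen (k : Fin 8) : ℂ := chi k 3 + chi k 4 + chi k 5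

lemma pen_eq (k : Fin 8) : pen k = (omega ^ (k : ℕ)) ^ 3 + (omega ^ (k : ℕ)) ^ 4
    + (omega ^ (k : ℕ)) ^ 5 := by
  simp only [pen, chi, pow_mul]; rfl

lemma omega_three_five : omega ^ 3 + omega ^ 5 = -((Real.sqrt 2 : ℝ) : ℂ) := by
  rw [show omega ^ 3 + omega ^ 5 = omega ^ 2 * omega + omega ^ 4 * omega by ring,
    omega_sq, omega_four, omega_eq]
  push_cast
  linear_combination (((Real.sqrt 2 : ℝ) : ℂ) / 2) * Complex.I_sq

lemma pen_one : pen 1 = -1 - ((Real.sqrt 2 : ℝ) : ℂ) := by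
  rw [pen_eq]
  have : ((1 : Fin 8) : ℕ) = 1 := rfl
  rw [this]
  linear_combination omega_three_five + omega_four

lemma pen_seven : pen 7 = -1 - ((Real.sqrt 2 : ℝ) : ℂ) := by
  have h : pen 7 = omega ^ 21 + omega ^ 28 + omega ^ 35 := by
    simp only [pen_eq, ← pow_mul]; rfl
  rw [h, omega_pow_congr (show 21 % 8 = 5 % 8 by rfl),
    omega_pow_congr (show 28 % 8 = 4 % 8 by rfl), omega_pow_congr (show 35 % 8 = 3 % 8 by rfl)]
  linear_combination omega_three_five + omega_four

lemma pen_other (k : Fin 8) (h1 : k ≠ 1) (h7 : k ≠ 7) :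
    ∃ r : ℝ, pen k = r ∧ e1 - r < -4 := by
  have hs : (1.414 : ℝ) < Real.sqrt 2 := by
    rw [Real.lt_sqrt (by norm_num)]; norm_num
  have h : pen k = omega ^ ((k : ℕ) * 3) + omega ^ ((k : ℕ) * 4) + omega ^ ((k : ℕ) * 5) := by
    simp only [pen_eq, ← pow_mul]
  have w2 := omega_sq
  have w4 := omega_four
  have w6 : omega ^ 6 = -Complex.I := by
    rw [show omega ^ 6 = omega ^ 4 * omega ^ 2 by ring, w2, w4]; ring
  have w35 := omega_three_five
  have w17 : omega ^ 1 + omega ^ 7 = ((Real.sqrt 2 : ℝ) : ℂ) := by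
    linear_combination (omega + omega ^ 3) * w4 - w35
  unfold e1
  obtain ⟨k, hk⟩ := k
  simp only at h
  rw [h]
  interval_cases k
  · exact ⟨3, by norm_num, by linarith⟩
  · exact absurd rfl h1
  · refine ⟨1, ?_, by linarith⟩
    rw [omega_pow_congr (show 2 * 3 % 8 = 6 % 8 by rfl),
      omega_pow_congr (show 2 * 4 % 8 = 0 % 8 by rfl),
      omega_pow_congr (show 2 * 5 % 8 = 2 % 8 by rfl), w2, w6]; simp
  · refine ⟨-1 + Real.sqrt 2, ?_, by linarith⟩
    rw [omega_pow_congr (show 3 * 3 % 8 = 1 % 8 by rfl),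
      omega_pow_congr (show 3 * 4 % 8 = 4 % 8 by rfl),
      omega_pow_congr (show 3 * 5 % 8 = 7 % 8 by rfl)]
    push_cast
    linear_combination w17 + w4
  · refine ⟨-1, ?_, by linarith⟩
    rw [omega_pow_congr (show 4 * 3 % 8 = 4 % 8 by rfl),
      omega_pow_congr (show 4 * 4 % 8 = 0 % 8 by rfl),
      omega_pow_congr (show 4 * 5 % 8 = 4 % 8 by rfl), w4]; simp
  · refine ⟨-1 + Real.sqrt 2, ?_, by linarith⟩
    rw [omega_pow_congr (show 5 * 3 % 8 = 7 % 8 by rfl),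
      omega_pow_congr (show 5 * 4 % 8 = 4 % 8 by rfl),
      omega_pow_congr (show 5 * 5 % 8 = 1 % 8 by rfl)]
    push_cast
    linear_combination w17 + w4
  · refine ⟨1, ?_, by linarith⟩
    rw [omega_pow_congr (show 6 * 3 % 8 = 2 % 8 by rfl),
      omega_pow_congr (show 6 * 4 % 8 = 0 % 8 by rfl),
      omega_pow_congr (show 6 * 5 % 8 = 6 % 8 by rfl), w2, w6]; simp
  · exact absurd rfl h7

/-- Good gates: unitary, with entries of `-√2 W` being `0` or powers of `ω`. -/
def Good {κ : Type*} [Fintype κ] [DecidableEq κ] (W : Matrix κ κ ℂ) : Prop :=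
  Wᴴ * W = 1 ∧ ∀ x y, IsW (-((Real.sqrt 2 : ℝ) : ℂ) * W x y)

lemma Good.conjT {κ : Type*} [Fintype κ] [DecidableEq κ] {W : Matrix κ κ ℂ} (h : Good W) :
    Good Wᴴ := by
  refine ⟨?_, ?_⟩
  · rw [Matrix.conjTranspose_conjTranspose]; exact mul_eq_one_comm.mp h.1
  · intro x y
    have := IsW_conj (h.2 y x)
    simpa [Matrix.conjTranspose_apply] using this

lemma IsW_zero : IsW 0 := Or.inl rfl
lemma IsW_neg_one : IsW (-1) := omega_four ▸ IsW_pow 4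
lemma IsW_one : IsW 1 := by simpa using IsW_pow 0
lemma IsW_omega : IsW omega := by simpa using IsW_pow 1
lemma IsW_neg_omega : IsW (-omega) := by
  have := IsW_pow 5
  rwa [show omega ^ 5 = -omega by linear_combination omega * omega_four] at this

lemma Hmat_apply (a b : Fin 2) : -((Real.sqrt 2 : ℝ) : ℂ) * Hmat a b
    = -(!![1, 1; 1, -1] : Matrix (Fin 2) (Fin 2) ℂ) a b := by
  have h2 : ((Real.sqrt 2 : ℝ) : ℂ) ≠ 0 := by
    intro h; have := sqrt2_sq; rw [h] at this; norm_num at this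
  simp only [Hmat, Matrix.smul_apply, Complex.real_smul]
  push_cast
  field_simp

lemma Hmat_unit : Hmatᴴ * Hmat = 1 := by
  have h : Hmat = (((Real.sqrt 2 : ℝ) : ℂ) / 2) • (!![1, 1; 1, -1] : Matrix (Fin 2) (Fin 2) ℂ) := by
    have h2 : ((Real.sqrt 2 : ℝ) : ℂ) ≠ 0 := by
      intro h; have := sqrt2_sq; rw [h] at this; norm_num at this
    ext a b
    simp only [Hmat, Matrix.smul_apply, Complex.real_smul, smul_eq_mul]
    congr 1
    push_cast
    field_simp
    linear_combination -sqrt2_sq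
  have h2 := sqrt2_sq
  rw [h]
  ext a b
  fin_cases a <;> fin_cases b <;>
    simp [Matrix.mul_apply, Fin.sum_univ_two, Matrix.conjTranspose_apply] <;>
    (try rw [show (starRingEnd ℂ) 2 = 2 from Complex.conj_ofNat 2]) <;>
    linear_combination (1/2) * h2

lemma good_H : Good Hmat := by
  refine ⟨Hmat_unit, fun x y => ?_⟩
  rw [Hmat_apply]
  fin_cases x <;> fin_cases y <;> simp [IsW_neg_one, IsW_one]

lemma good_HT : Good (Hmat * Tmat) := by
  refine ⟨?_, fun x y => ?_⟩
  · have hT : Tmatᴴ * Tmat = 1 := by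
      have : starRingEnd ℂ omega * omega = 1 := by
        rw [omega_conj]; linear_combination omega_eight
      ext a b
      fin_cases a <;> fin_cases b <;>
        simp [Tmat, Matrix.mul_apply, Fin.sum_univ_two, Matrix.conjTranspose_apply, this]
    rw [Matrix.conjTranspose_mul, Matrix.mul_assoc, ← Matrix.mul_assoc Hmatᴴ, Hmat_unit,
      Matrix.one_mul, hT]
  · rw [Matrix.mul_apply, Fin.sum_univ_two, mul_add, ← mul_assoc, ← mul_assoc, Hmat_apply,
      Hmat_apply]
    fin_cases x <;> fin_cases y <;>
      simp [Tmat, IsW_neg_one, IsW_omega, IsW_neg_omega]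

lemma HCNOT_apply (p q : Fin 2 × Fin 2) :
    HCNOT p q = Hmat p.1 q.1 * (if p.2 = q.2 + q.1 then 1 else 0) := by
  unfold HCNOT CNOTmat
  rw [Matrix.mul_apply, Finset.sum_eq_single (q.1, q.2 + q.1)]
  · simp
  · rintro ⟨a, b⟩ _ h
    simp only [Matrix.of_apply]
    rw [if_neg (c := a = q.1 ∧ b = q.2 + q.1), mul_zero]
    rintro ⟨rfl, rfl⟩
    exact h rfl
  · simp

lemma good_HCNOT : Good HCNOT := by
  refine ⟨?_, fun x y => ?_⟩
  · have hC : CNOTmatᴴ * CNOTmat = 1 := by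
      ext a b
      fin_cases a <;> fin_cases b <;>
        simp [CNOTmat, Matrix.mul_apply, Fintype.sum_prod_type, Fin.sum_univ_two,
          Matrix.conjTranspose_apply]
    have hH : (Matrix.of fun p q : Fin 2 × Fin 2 =>
        Hmat p.1 q.1 * (if p.2 = q.2 then (1 : ℂ) else 0))
        = Matrix.kronecker Hmat (1 : Matrix (Fin 2) (Fin 2) ℂ) := by
      ext p q
      simp [Matrix.kronecker, Matrix.kroneckerMap_apply, Matrix.one_apply]
    unfold HCNOT
    rw [hH, Matrix.conjTranspose_mul, Matrix.mul_assoc, ← Matrix.mul_assoc _ _ CNOTmat]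
    have : (Matrix.kronecker Hmat (1 : Matrix (Fin 2) (Fin 2) ℂ))ᴴ
        * (Matrix.kronecker Hmat (1 : Matrix (Fin 2) (Fin 2) ℂ)) = 1 := by
      simp only [Matrix.kronecker]
      rw [Matrix.conjTranspose_kronecker, ← Matrix.mul_kronecker_mul, Hmat_unit]
      simp
    rw [this, Matrix.one_mul, hC]
  · rw [HCNOT_apply, ← mul_assoc]
    split_ifs
    · rw [mul_one]; exact good_H.2 _ _
    · simp [IsW_zero]

lemma good_of_equiv {κ α β : Type*} [Fintype κ] [DecidableEq κ] [Fintype α] [DecidableEq α]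
    [Fintype β] [DecidableEq β] (e : κ ≃ α × β) (g : Matrix α α ℂ) (hg : Good g)
    (W : Matrix κ κ ℂ)
    (hW : ∀ x y, W x y = (if (e x).2 = (e y).2 then 1 else 0) * g (e x).1 (e y).1) :
    Good W := by
  have h : W = (Matrix.kronecker g (1 : Matrix β β ℂ)).submatrix e e := by
    ext x y
    rw [hW]
    simp [Matrix.kronecker, Matrix.kroneckerMap_apply, Matrix.one_apply]
  refine ⟨?_, fun x y => ?_⟩
  · rw [h, Matrix.conjTranspose_submatrix, Matrix.submatrix_mul_equiv]
    simp only [Matrix.kronecker]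
    rw [Matrix.conjTranspose_kronecker, ← Matrix.mul_kronecker_mul, hg.1]
    simp
  · rw [hW]
    split_ifs
    · rw [one_mul]; exact hg.2 _ _
    · simp [IsW_zero]

lemma good_single {n : ℕ} (g : Matrix (Fin 2) (Fin 2) ℂ) (hg : Good g) (q : Fin n) :
    Good (applySingle n g q) := by
  refine good_of_equiv (Equiv.funSplitAt q (Fin 2)) g hg _ fun x y => ?_
  simp only [applySingle, Matrix.of_apply, Equiv.funSplitAt_apply, funext_iff, Subtype.forall]

/-- Split off two coordinates. -/
def splitTwo {n : ℕ} (q r : Fin n) (h : q ≠ r) :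
    (Fin n → Fin 2) ≃ (Fin 2 × Fin 2) × ({u : Fin n // u ≠ q ∧ u ≠ r} → Fin 2) where
  toFun x := ((x q, x r), fun u => x u)
  invFun p := fun u => if h1 : u = q then p.1.1 else if h2 : u = r then p.1.2
    else p.2 ⟨u, h1, h2⟩
  left_inv x := by
    funext u
    by_cases h1 : u = q
    · simp [h1]
    · by_cases h2 : u = r
      · subst h2; simp [h1]
      · simp [h1, h2]
  right_inv p := by
    obtain ⟨⟨a, b⟩, f⟩ := p
    simp only [dite_true, Prod.mk.injEq, true_and]
    refine ⟨by simp [h.symm], ?_⟩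
    funext u
    simp [u.2.1, u.2.2]

lemma good_two {n : ℕ} (g : Matrix (Fin 2 × Fin 2) (Fin 2 × Fin 2) ℂ) (hg : Good g)
    (q r : Fin n) (h : q ≠ r) : Good (applyTwo n g q r) := by
  refine good_of_equiv (splitTwo q r h) g hg _ fun x y => ?_
  simp only [applyTwo, Matrix.of_apply, splitTwo, Equiv.coe_fn_mk, funext_iff, Subtype.forall,
    and_imp]

lemma good_allowed {n : ℕ} {W : Matrix (QState n) (QState n) ℂ} (h : AllowedGate n W) :
    Good W := by
  rcases h with ⟨q, rfl | rfl | rfl⟩ | ⟨q, r, hqr, rfl⟩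
  · exact good_single _ good_H q
  · exact good_single _ good_HT q
  · exact good_single _ good_HT.conjT q
  · exact good_two _ good_HCNOT q r hqr

end QC
namespace QC

/-- Fourier component in the `ℂ⁸` register. -/
noncomputable def four {n M : ℕ} (v : CVertex n M → ℂ) (k : Fin 8) (x : QState n)
    (t : Fin (2 * M)) : ℂ := ∑ j, chi k j * v (x, t, j)

/-- The Hamiltonian in the `k`-th sector. -/
noncomputable def opk (n M : ℕ) (W : ℕ → Matrix (QState n) (QState n) ℂ) (k : Fin 8)
    (f : QState n → Fin (2 * M) → ℂ) (x : QState n) (t : Fin (2 * M)) : ℂ :=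
  ∑ y, starRingEnd ℂ (ck k (-((Real.sqrt 2 : ℝ) : ℂ) * W t y x)) * f y (cycSucc t)
  + (∑ s : Fin (2 * M), if t = cycSucc s then
      ∑ y, ck k (-((Real.sqrt 2 : ℝ) : ℂ) * W s x y) * f y s else 0)
  + pen k * f x t

lemma Hprop_mulVec (n M : ℕ) (U : ℕ → Matrix (QState n) (QState n) ℂ) (v : CVertex n M → ℂ)
    (x : QState n) (t : Fin (2 * M)) (i : Fin 8) :
    (HpropC n M U *ᵥ v) (x, t, i) =
      ∑ y, ∑ j, (if -((Real.sqrt 2 : ℝ) : ℂ) * Wseq n M U t y x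
          = omega ^ ((j - i : Fin 8) : ℕ) then 1 else 0) * v (y, cycSucc t, j)
      + ∑ s : Fin (2 * M), if t = cycSucc s then
        ∑ y, ∑ j, (if -((Real.sqrt 2 : ℝ) : ℂ) * Wseq n M U s x y
          = omega ^ ((i - j : Fin 8) : ℕ) then 1 else 0) * v (y, s, j) else 0 := by
  simp only [Matrix.mulVec, dotProduct, HpropC, Matrix.of_apply, Fintype.sum_prod_type,
    Bmat, Matrix.conjTranspose_apply, Matrix.smul_apply, smul_eq_mul, Finset.sum_add_distrib,
    add_mul]
  congr 1
  · refine Finset.sum_congr rfl fun y _ => ?_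
    rw [Finset.sum_eq_single (cycSucc t)]
    · refine Finset.sum_congr rfl fun j _ => ?_
      congr 1
      rw [Finset.sum_eq_single t]
      · simp [apply_ite]
      · intro s _ hs
        rw [if_neg]
        exact fun h => hs h.1.symm
      · simp
    · intro t' _ ht'
      refine Finset.sum_eq_zero fun j _ => ?_
      rw [Finset.sum_eq_zero, zero_mul]
      intro s _
      rw [if_neg]
      rintro ⟨rfl, rfl⟩
      exact ht' rfl
    · simp
  · have : ∀ s : Fin (2 * M), (if t = cycSucc s then
        ∑ y, ∑ j, (if -((Real.sqrt 2 : ℝ) : ℂ) * Wseq n M U s x y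
          = omega ^ ((i - j : Fin 8) : ℕ) then 1 else 0) * v (y, s, j) else 0)
        = ∑ y, ∑ j, (if t = cycSucc s then
          (if -((Real.sqrt 2 : ℝ) : ℂ) * Wseq n M U s x y
          = omega ^ ((i - j : Fin 8) : ℕ) then 1 else 0) else 0) * v (y, s, j) := by
      intro s
      split_ifs <;> simp
    simp_rw [this]
    rw [Finset.sum_comm]
    refine Finset.sum_congr rfl fun t' _ => Finset.sum_congr rfl fun y _ =>
      Finset.sum_congr rfl fun j _ => ?_
    congr 1
    rw [Finset.sum_eq_single t']
    · simp
    · intro s _ hs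
      rw [if_neg]
      exact fun h => hs h.2.symm
    · simp

lemma S8_pow_apply (m : ℕ) (i j : Fin 8) :
    (S8 ^ m) i j = if i = j + Fin.ofNat 8 m then 1 else 0 := by
  induction m generalizing i j with
  | zero => simp [Matrix.one_apply]
  | succ m ih =>
    rw [pow_succ, Matrix.mul_apply, Finset.sum_eq_single (j + 1)]
    · rw [ih]
      have : j + 1 + Fin.ofNat 8 m = j + Fin.ofNat 8 (m + 1) := by
        apply Fin.ext; simp [Fin.val_add, Fin.ofNat]; omega
      rw [this]; simp [S8]
    · intro b _ hb
      simp [S8, hb]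
    · simp

lemma Hpen_mulVec (n M : ℕ) (v : CVertex n M → ℂ)
    (x : QState n) (t : Fin (2 * M)) (i : Fin 8) :
    (HpenC n M *ᵥ v) (x, t, i) = v (x, t, i - 3) + v (x, t, i - 4) + v (x, t, i - 5) := by
  simp only [Matrix.mulVec, dotProduct, HpenC, Matrix.of_apply, Fintype.sum_prod_type]
  rw [Finset.sum_eq_single x, Finset.sum_eq_single t]
  · simp only [and_self, if_true, Matrix.add_apply, S8_pow_apply, add_mul,
      Finset.sum_add_distrib]
    have : ∀ c : Fin 8, ∑ j, (if i = j + c then (1 : ℂ) else 0) * v (x, t, j)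
        = v (x, t, i - c) := by
      intro c
      rw [Finset.sum_eq_single (i - c)]
      · simp
      · intro b _ hb
        rw [if_neg, zero_mul]
        rintro rfl
        exact hb (by simp)
      · simp
    rw [this, this, this]
    rfl
  · intro b _ hb
    refine Finset.sum_eq_zero fun j _ => ?_
    rw [if_neg, zero_mul]
    exact fun h => hb h.2.symm
  · simp
  · intro b _ hb
    refine Finset.sum_eq_zero fun s _ => Finset.sum_eq_zero fun j _ => ?_
    rw [if_neg, zero_mul]
    exact fun h => hb h.1.symm
  · simp

lemma conv_one (k : Fin 8) (z : ℂ) (w : Fin 8 → ℂ) :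
    ∑ i, chi k i * ∑ j, (if z = omega ^ ((i - j : Fin 8) : ℕ) then 1 else 0) * w j
      = ck k z * ∑ j, chi k j * w j := by
  simp_rw [Finset.mul_sum]
  rw [Finset.sum_comm]
  refine Finset.sum_congr rfl fun j _ => ?_
  unfold ck
  rw [Finset.sum_mul, ← Equiv.sum_comp (Equiv.addRight j)]
  refine Finset.sum_congr rfl fun d _ => ?_
  simp only [Equiv.coe_addRight, add_sub_cancel_right, chi_add]
  split_ifs <;> ring

lemma conv_two (k : Fin 8) (z : ℂ) (w : Fin 8 → ℂ) :
    ∑ i, chi k i * ∑ j, (if z = omega ^ ((j - i : Fin 8) : ℕ) then 1 else 0) * w j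
      = starRingEnd ℂ (ck k z) * ∑ j, chi k j * w j := by
  simp_rw [Finset.mul_sum]
  rw [Finset.sum_comm]
  refine Finset.sum_congr rfl fun j _ => ?_
  unfold ck
  rw [map_sum, Finset.sum_mul, ← (Equiv.subLeft j).sum_comp]
  refine Finset.sum_congr rfl fun d _ => ?_
  simp only [Equiv.subLeft_apply, sub_sub_cancel]
  have h : chi k j = chi k (j - d) * chi k d := by rw [← chi_add, sub_add_cancel]
  split_ifs
  · rw [h]
    linear_combination (-chi k (j - d) * w j) * chi_conj_mul k d
  · simp

lemma conv_shift (k c : Fin 8) (w : Fin 8 → ℂ) :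
    ∑ i, chi k i * w (i - c) = chi k c * ∑ j, chi k j * w j := by
  rw [Finset.mul_sum, ← Equiv.sum_comp (Equiv.addRight c)]
  refine Finset.sum_congr rfl fun d _ => ?_
  simp only [Equiv.coe_addRight, add_sub_cancel_right, chi_add]
  ring

lemma four_A (n M : ℕ) (U : ℕ → Matrix (QState n) (QState n) ℂ) (v : CVertex n M → ℂ)
    (k : Fin 8) (x : QState n) (t : Fin (2 * M)) :
    four ((HpropC n M U + HpenC n M) *ᵥ v) k x t
      = opk n M (Wseq n M U) k (four v k) x t := by
  unfold opk
  simp only [four, Matrix.add_mulVec, Pi.add_apply, mul_add, Hprop_mulVec, Hpen_mulVec,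
    Finset.sum_add_distrib]
  congr 1
  · congr 1
    · simp_rw [← conv_two]
      rw [Finset.sum_comm]
      simp_rw [Finset.mul_sum]
    · simp_rw [← conv_one, Finset.mul_sum]
      rw [Finset.sum_comm]
      refine Finset.sum_congr rfl fun s _ => ?_
      split_ifs
      · rw [Finset.sum_comm]
        simp_rw [Finset.mul_sum]
      · simp
  · rw [conv_shift k 3 (fun j => v (x, t, j)), conv_shift k 4 (fun j => v (x, t, j)),
      conv_shift k 5 (fun j => v (x, t, j))]
    simp only [pen, add_mul]

lemma four_inv {n M : ℕ} (v : CVertex n M → ℂ) (x : QState n) (t : Fin (2 * M)) (j : Fin 8) :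
    8 * v (x, t, j) = ∑ k, four v k x t * starRingEnd ℂ (chi k j) := by
  simp only [four, Finset.sum_mul]
  rw [Finset.sum_comm]
  have : ∀ i, ∑ k, chi k i * v (x, t, i) * starRingEnd ℂ (chi k j)
      = (if i = j then 8 else 0) * v (x, t, i) := by
    intro i
    rw [← chi_orth', Finset.sum_mul]
    exact Finset.sum_congr rfl fun k _ => by ring
  simp_rw [this]
  simp

lemma four_inj {n M : ℕ} {v w : CVertex n M → ℂ} (h : ∀ k x t, four v k x t = four w k x t) :
    v = w := by
  funext ⟨x, t, j⟩
  have h1 := four_inv v x t j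
  have h2 := four_inv w x t j
  simp_rw [h] at h1
  rw [← h2] at h1
  exact mul_left_cancel₀ (by norm_num) h1

lemma four_smul {n M : ℕ} (c : ℂ) (v : CVertex n M → ℂ) (k : Fin 8) (x : QState n)
    (t : Fin (2 * M)) : four (c • v) k x t = c * four v k x t := by
  simp only [four, Pi.smul_apply, smul_eq_mul, Finset.mul_sum]
  exact Finset.sum_congr rfl fun k _ => by ring

lemma eig_iff (n M : ℕ) (U : ℕ → Matrix (QState n) (QState n) ℂ) (v : CVertex n M → ℂ) (c : ℂ) :
    (HpropC n M U + HpenC n M) *ᵥ v = c • v ↔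
      ∀ k x t, opk n M (Wseq n M U) k (four v k) x t = c * four v k x t := by
  constructor
  · intro h k x t
    rw [← four_A, h, four_smul]
  · intro h
    apply four_inj
    intro k x t
    rw [four_A, h, four_smul]

/-- A vector supported in one sector. -/
noncomputable def sect {n M : ℕ} (g : QState n → Fin (2 * M) → ℂ) (l : Fin 8) :
    CVertex n M → ℂ := fun p => g p.1 p.2.1 * starRingEnd ℂ (chi l p.2.2)

lemma four_sect {n M : ℕ} (g : QState n → Fin (2 * M) → ℂ) (k l : Fin 8) (x : QState n)
    (t : Fin (2 * M)) : four (sect g l) k x t = if k = l then 8 * g x t else 0 := by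
  have := chi_orth k l
  simp only [four, sect]
  have h : ∀ j, chi k j * (g x t * starRingEnd ℂ (chi l j))
      = (chi k j * starRingEnd ℂ (chi l j)) * g x t := fun j => by ring
  simp_rw [h]
  rw [← Finset.sum_mul, this]
  split_ifs <;> simp

lemma cycSucc_bij (m : ℕ) : Function.Bijective (cycSucc : Fin m → Fin m) := by
  rw [Fintype.bijective_iff_injective_and_card]
  refine ⟨fun a b h => ?_, rfl⟩
  have h' : ((a : ℕ) + 1) % m = ((b : ℕ) + 1) % m := congrArg Fin.val h
  have ha := a.2
  have hb := b.2
  apply Fin.ext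
  rcases Nat.lt_or_ge ((a : ℕ) + 1) m with h1 | h1 <;>
  rcases Nat.lt_or_ge ((b : ℕ) + 1) m with h2 | h2
  · rw [Nat.mod_eq_of_lt h1, Nat.mod_eq_of_lt h2] at h'; omega
  · rw [Nat.mod_eq_of_lt h1, show (b : ℕ) + 1 = m by omega, Nat.mod_self] at h'; omega
  · rw [Nat.mod_eq_of_lt h2, show (a : ℕ) + 1 = m by omega, Nat.mod_self] at h'; omega
  · omega

lemma sum_succ_ite {m : ℕ} (G : Fin m → ℂ) (s : Fin m) :
    (∑ s', if cycSucc s = cycSucc s' then G s' else 0) = G s := by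
  rw [Finset.sum_eq_single s]
  · simp
  · intro b _ hb
    rw [if_neg]
    exact fun h => hb ((cycSucc_bij m).1 h).symm
  · simp

/-- Sectors with no eigenvector. -/
lemma opk_zero (n M : ℕ) (W : ℕ → Matrix (QState n) (QState n) ℂ)
    (hW : ∀ t, t < 2 * M → Good (W t)) (k : Fin 8) (h1 : k ≠ 1) (h7 : k ≠ 7)
    (f : QState n → Fin (2 * M) → ℂ) (h : ∀ x t, opk n M W k f x t = (e1 : ℂ) * f x t) :
    ∀ x t, f x t = 0 := by
  obtain ⟨r, hr, hlt⟩ := pen_other k h1 h7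
  intro x0 t0
  obtain ⟨⟨x, t⟩, hmax⟩ : ∃ p : QState n × Fin (2 * M), ∀ q : QState n × Fin (2 * M),
      ‖f q.1 q.2‖ ≤ ‖f p.1 p.2‖ := by
    have : Nonempty (QState n × Fin (2 * M)) := ⟨(x0, t0)⟩
    exact Finite.exists_max fun p : QState n × Fin (2 * M) => ‖f p.1 p.2‖
  obtain ⟨s, rfl⟩ := (cycSucc_bij (2 * M)).2 t
  have hrow : ∀ (V : Matrix (QState n) (QState n) ℂ), Good V → ∀ x,
      ∑ y, ‖ck k (-((Real.sqrt 2 : ℝ) : ℂ) * V y x)‖ = 2 := by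
    intro V hV x
    have hd : ∑ y, ‖V y x‖ ^ 2 = 1 := by
      have := congrFun (congrFun hV.1 x) x
      rw [Matrix.mul_apply, Matrix.one_apply_eq] at this
      have h2 : ∀ y, Vᴴ x y * V y x = ((‖V y x‖ ^ 2 : ℝ) : ℂ) := by
        intro y
        rw [Matrix.conjTranspose_apply, ← Complex.normSq_eq_norm_sq,
          Complex.normSq_eq_conj_mul_self]; rfl
      simp_rw [h2] at this
      exact_mod_cast this
    have h2 : ∀ y, ‖ck k (-((Real.sqrt 2 : ℝ) : ℂ) * V y x)‖ = 2 * ‖V y x‖ ^ 2 := by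
      intro y
      rw [ck_norm k (hV.2 y x), norm_mul, norm_neg, Complex.norm_real, mul_pow,
        Real.norm_eq_abs, sq_abs, Real.sq_sqrt (by norm_num)]
    simp_rw [h2]
    rw [← Finset.mul_sum, hd]; norm_num
  have heq := h x (cycSucc s)
  unfold opk at heq
  rw [sum_succ_ite (fun s => ∑ y, ck k (-((Real.sqrt 2 : ℝ) : ℂ) * W s x y) * f y s), hr] at heq
  set m := ‖f x (cycSucc s)‖ with hm
  have b1 : ‖∑ y, starRingEnd ℂ (ck k (-((Real.sqrt 2 : ℝ) : ℂ) * W (cycSucc s) y x))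
      * f y (cycSucc (cycSucc s))‖ ≤ 2 * m := by
    refine (norm_sum_le _ _).trans ?_
    have h2 := congrArg (· * m) (hrow _ (hW (cycSucc s) (cycSucc s).2) x)
    simp only [Finset.sum_mul] at h2
    refine le_trans ?_ h2.le
    refine Finset.sum_le_sum fun y _ => ?_
    rw [norm_mul, RCLike.norm_conj]
    exact mul_le_mul_of_nonneg_left (hmax (y, _)) (norm_nonneg _)
  have b2 : ‖∑ y, ck k (-((Real.sqrt 2 : ℝ) : ℂ) * W s x y) * f y s‖ ≤ 2 * m := by
    refine (norm_sum_le _ _).trans ?_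
    have h2 := congrArg (· * m) (hrow _ (hW s s.2).conjT x)
    simp only [Finset.sum_mul] at h2
    refine le_trans ?_ h2.le
    refine Finset.sum_le_sum fun y _ => ?_
    rw [norm_mul]
    refine mul_le_mul (le_of_eq ?_) (hmax (y, _)) (norm_nonneg _) (norm_nonneg _)
    rw [ck_norm k ((hW s s.2).2 _ _), ck_norm k ((hW s s.2).conjT.2 _ _), norm_mul, norm_mul,
      Matrix.conjTranspose_apply, norm_star]
  have b3 : ‖(((e1 - r : ℝ)) : ℂ) * f x (cycSucc s)‖ ≤ 4 * m := by
    have : (((e1 - r : ℝ)) : ℂ) * f x (cycSucc s)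
      = ∑ y, starRingEnd ℂ (ck k (-((Real.sqrt 2 : ℝ) : ℂ) * W (cycSucc s) y x))
      * f y (cycSucc (cycSucc s)) + ∑ y, ck k (-((Real.sqrt 2 : ℝ) : ℂ) * W s x y) * f y s := by
      push_cast
      linear_combination -heq
    rw [this]
    refine (norm_add_le _ _).trans ?_
    linarith
  rw [norm_mul, Complex.norm_real, Real.norm_eq_abs, abs_of_neg (by linarith), ← hm] at b3
  have m0 : 0 ≤ m := norm_nonneg _
  have : m = 0 := by nlinarith
  have h0 := hmax (x0, t0)
  simp only [this] at h0
  exact norm_le_zero_iff.mp h0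

/-- The key sector lemma. -/
lemma opk_iff (n M : ℕ) (W V : ℕ → Matrix (QState n) (QState n) ℂ) (k : Fin 8)
    (hV : ∀ t, t < 2 * M → (V t)ᴴ * V t = 1)
    (hk : pen k = -1 - ((Real.sqrt 2 : ℝ) : ℂ))
    (hck : ∀ t, t < 2 * M → ∀ x y, ck k (-((Real.sqrt 2 : ℝ) : ℂ) * W t x y)
      = -((Real.sqrt 2 : ℝ) : ℂ) * V t x y)
    (f : QState n → Fin (2 * M) → ℂ) :
    (∀ x t, opk n M W k f x t = (e1 : ℂ) * f x t) ↔
      ∀ s : Fin (2 * M), (fun x => f x (cycSucc s)) = V s *ᵥ fun x => f x s := by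
  have h2 : ((Real.sqrt 2 : ℝ) : ℂ) ≠ 0 := by
    intro h; have := sqrt2_sq; rw [h] at this; norm_num at this
  have key : ∀ x s, opk n M W k f x (cycSucc s) - (e1 : ℂ) * f x (cycSucc s)
      = -((Real.sqrt 2 : ℝ) : ℂ) * (((V (cycSucc s))ᴴ *ᵥ fun x => f x (cycSucc (cycSucc s))) x
        + (V s *ᵥ fun x => f x s) x - 2 * f x (cycSucc s)) := by
    intro x s
    unfold opk
    rw [sum_succ_ite (fun s => ∑ y, ck k (-((Real.sqrt 2 : ℝ) : ℂ) * W s x y) * f y s), hk]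
    have a1 : ∑ y, starRingEnd ℂ (ck k (-((Real.sqrt 2 : ℝ) : ℂ) * W (cycSucc s) y x))
      * f y (cycSucc (cycSucc s)) = -((Real.sqrt 2 : ℝ) : ℂ) *
        ((V (cycSucc s))ᴴ *ᵥ fun x => f x (cycSucc (cycSucc s))) x := by
      simp only [Matrix.mulVec, dotProduct, Finset.mul_sum]
      refine Finset.sum_congr rfl fun y _ => ?_
      rw [hck _ (cycSucc s).2, Matrix.conjTranspose_apply, map_mul, map_neg, Complex.conj_ofReal]
      simp only [starRingEnd_apply]
      ring
    have a2 : ∑ y, ck k (-((Real.sqrt 2 : ℝ) : ℂ) * W s x y) * f y s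
        = -((Real.sqrt 2 : ℝ) : ℂ) * (V s *ᵥ fun x => f x s) x := by
      simp only [Matrix.mulVec, dotProduct, Finset.mul_sum]
      refine Finset.sum_congr rfl fun y _ => ?_
      rw [hck _ s.2]
      ring
    rw [a1, a2]
    simp only [e1]
    push_cast
    ring
  constructor
  · intro h
    have h3 : ∀ s : Fin (2 * M), ((V (cycSucc s))ᴴ *ᵥ fun x => f x (cycSucc (cycSucc s)))
        + (V s *ᵥ fun x => f x s) = (2 : ℂ) • fun x => f x (cycSucc s) := by
      intro s
      funext x
      have := key x s
      rw [h, sub_self] at this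
      have := (mul_eq_zero.mp this.symm).resolve_left (neg_ne_zero.mpr h2)
      simp only [Pi.add_apply, Pi.smul_apply, smul_eq_mul]
      linear_combination this
    set g : Fin (2 * M) → QState n → ℂ := fun t x => f x t with hg
    have h4 : ∀ s : Fin (2 * M), star (g (cycSucc s)) ⬝ᵥ ((V (cycSucc s))ᴴ *ᵥ g (cycSucc (cycSucc s)))
        + star (g (cycSucc s)) ⬝ᵥ (V s *ᵥ g s) = 2 * (star (g (cycSucc s)) ⬝ᵥ g (cycSucc s)) := by
      intro s
      have := congrArg (fun w => star (g (cycSucc s)) ⬝ᵥ w) (h3 s)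
      simpa only [dotProduct_add, dotProduct_smul, smul_eq_mul] using this
    have re : ∀ G : Fin (2 * M) → ℂ, ∑ s, G (cycSucc s) = ∑ s, G s := fun G =>
      (Equiv.ofBijective _ (cycSucc_bij (2 * M))).sum_comp G
    have h5 : ∑ s : Fin (2 * M), star (g (cycSucc s) - V s *ᵥ g s) ⬝ᵥ (g (cycSucc s) - V s *ᵥ g s)
        = 0 := by
      have e : ∀ s : Fin (2 * M),
          star (g (cycSucc s) - V s *ᵥ g s) ⬝ᵥ (g (cycSucc s) - V s *ᵥ g s)
          = star (g (cycSucc s)) ⬝ᵥ g (cycSucc s) - star (g (cycSucc s)) ⬝ᵥ (V s *ᵥ g s)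
            - star (g s) ⬝ᵥ ((V s)ᴴ *ᵥ g (cycSucc s)) + star (g s) ⬝ᵥ g s := by
        intro s
        have u : star (V s *ᵥ g s) ⬝ᵥ (V s *ᵥ g s) = star (g s) ⬝ᵥ g s := by
          rw [Matrix.star_mulVec, ← Matrix.dotProduct_mulVec, Matrix.mulVec_mulVec, hV s s.2,
            Matrix.one_mulVec]
        have u2 : star (V s *ᵥ g s) ⬝ᵥ g (cycSucc s)
            = star (g s) ⬝ᵥ ((V s)ᴴ *ᵥ g (cycSucc s)) := by
          rw [Matrix.star_mulVec, ← Matrix.dotProduct_mulVec]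
        rw [star_sub, sub_dotProduct, dotProduct_sub, dotProduct_sub, u, u2]
        ring
      have s4 := Finset.sum_congr (rfl : (Finset.univ : Finset (Fin (2 * M))) = Finset.univ)
        fun s _ => h4 s
      rw [Finset.sum_add_distrib, ← Finset.mul_sum,
        re (fun s => star (g s) ⬝ᵥ ((V s)ᴴ *ᵥ g (cycSucc s))),
        re (fun s => star (g s) ⬝ᵥ g s)] at s4
      simp_rw [e]
      rw [Finset.sum_add_distrib, Finset.sum_sub_distrib, Finset.sum_sub_distrib,
        re (fun s => star (g s) ⬝ᵥ g s)]
      linear_combination -s4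
    intro s
    open scoped ComplexOrder in
    have h6 := (Finset.sum_eq_zero_iff_of_nonneg
      (fun s _ => dotProduct_star_self_nonneg (g (cycSucc s) - V s *ᵥ g s))).mp h5 s
      (Finset.mem_univ _)
    open scoped ComplexOrder in
    rw [dotProduct_star_self_eq_zero] at h6
    exact sub_eq_zero.mp h6
  · intro h x t
    obtain ⟨s, rfl⟩ := (cycSucc_bij (2 * M)).2 t
    rw [← sub_eq_zero, key, h (cycSucc s), Matrix.mulVec_mulVec, hV _ (cycSucc s).2,
      Matrix.one_mulVec, ← h s]
    ring

end QC
namespace QC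

lemma good_W (n M : ℕ)
    (U : ℕ → Matrix (QState n) (QState n) ℂ)
    (hU : ∀ i, i < M → AllowedGate n (U i)) (t : ℕ) (ht : t < 2 * M) : Good (Wseq n M U t) := by
  unfold Wseq
  split_ifs with h
  · exact good_allowed (hU t h)
  · exact (good_allowed (hU _ (by omega))).conjT

lemma Wp_zero (n M : ℕ)
    (U : ℕ → Matrix (QState n) (QState n) ℂ) : Wpartial n M U 0 = 1 := by simp [Wpartial]

lemma Wp_succ (n M : ℕ)
    (U : ℕ → Matrix (QState n) (QState n) ℂ) (t : ℕ) : Wpartial n M U (t + 1) = Wseq n M U t * Wpartial n M U t := by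
  simp [Wpartial, List.range_succ]

lemma Wp_unit (n M : ℕ)
    (U : ℕ → Matrix (QState n) (QState n) ℂ)
    (hU : ∀ i, i < M → AllowedGate n (U i)) (t : ℕ) (ht : t ≤ 2 * M) : (Wpartial n M U t)ᴴ * Wpartial n M U t = 1 := by
  induction t with
  | zero => simp [Wp_zero]
  | succ t ih =>
    rw [Wp_succ, Matrix.conjTranspose_mul, Matrix.mul_assoc, ← Matrix.mul_assoc _ (Wseq n M U t),
      (good_W n M U hU t (by omega)).1, Matrix.one_mul, ih (by omega)]

lemma Wp_refl (n M : ℕ)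
    (U : ℕ → Matrix (QState n) (QState n) ℂ)
    (hU : ∀ i, i < M → AllowedGate n (U i)) (j : ℕ) (hj : j ≤ M) : Wpartial n M U (M + j) = Wpartial n M U (M - j) := by
  induction j with
  | zero => rfl
  | succ j ih =>
    rw [← add_assoc, Wp_succ, ih (by omega)]
    obtain ⟨i, hi⟩ : ∃ i, M - j = i + 1 := ⟨M - j - 1, by omega⟩
    rw [hi, Wp_succ, ← Matrix.mul_assoc]
    have h1 : Wseq n M U (M + j) = (U i)ᴴ := by
      unfold Wseq
      rw [if_neg (by omega), show 2 * M - 1 - (M + j) = i by omega]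
    have h2 : Wseq n M U i = U i := by
      unfold Wseq
      rw [if_pos (by omega)]
    rw [h1, h2, (good_allowed (hU i (by omega))).1, Matrix.one_mul,
      show M - (j + 1) = i by omega]

lemma Wp_full (n M : ℕ)
    (U : ℕ → Matrix (QState n) (QState n) ℂ)
    (hU : ∀ i, i < M → AllowedGate n (U i)) : Wpartial n M U (2 * M) = 1 := by
  rw [two_mul, Wp_refl n M U hU M le_rfl, Nat.sub_self, Wp_zero]

lemma Wp_cyc (n M : ℕ)
    (U : ℕ → Matrix (QState n) (QState n) ℂ)
    (hU : ∀ i, i < M → AllowedGate n (U i)) (s : Fin (2 * M)) : Wpartial n M U (cycSucc s : Fin (2 * M))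
    = Wseq n M U s * Wpartial n M U s := by
  rw [← Wp_succ]
  have hs := s.2
  simp only [cycSucc]
  rcases Nat.lt_or_ge ((s : ℕ) + 1) (2 * M) with h | h
  · rw [Nat.mod_eq_of_lt h]
  · rw [show (s : ℕ) + 1 = 2 * M by omega, Nat.mod_self, Wp_zero, Wp_full n M U hU]

/-- Normalisation constant. -/
noncomputable def cst (M : ℕ) : ℂ :=
  (((1 : ℝ) / Real.sqrt (2 * M) : ℝ) : ℂ) * (((1 : ℝ) / Real.sqrt 8 : ℝ) : ℂ)

lemma chi_one_conj (j : Fin 8) : starRingEnd ℂ (chi 1 j) = omega ^ (-(j : ℤ)) := by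
  rw [← Complex.inv_eq_conj (chi_norm 1 j)]
  simp [chi]

lemma chi_seven_conj (j : Fin 8) : starRingEnd ℂ (chi 7 j) = omega ^ (j : ℕ) := by
  simp only [chi, map_pow, omega_conj]
  rw [← pow_mul]
  apply omega_pow_congr
  have : ((7 : Fin 8) : ℕ) = 7 := rfl
  rw [this]
  omega

lemma hist_sect (n M : ℕ)
    (U : ℕ → Matrix (QState n) (QState n) ℂ) (φ : QState n) :
    histVec n M U φ = sect (fun x t => cst M * Wpartial n M U t x φ) 1 := by
  funext p
  simp only [histVec, sect, omegaVec, cst, chi_one_conj]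
  ring

lemma histConj_sect (n M : ℕ)
    (U : ℕ → Matrix (QState n) (QState n) ℂ) (φ : QState n) :
    histVecConj n M U φ
      = sect (fun x t => cst M * starRingEnd ℂ (Wpartial n M U t x φ)) 7 := by
  funext p
  simp only [histVecConj, sect, omegaStarVec, cst, chi_seven_conj]
  ring

lemma sect_dot (n M : ℕ) (g h : QState n → Fin (2 * M) → ℂ) (k l : Fin 8) :
    star (sect g k) ⬝ᵥ sect h l
      = (∑ t, ∑ x, starRingEnd ℂ (g x t) * h x t) * (if k = l then 8 else 0) := by
  rw [← chi_orth k l]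
  simp only [dotProduct, Fintype.sum_prod_type, sect, Pi.star_apply]
  rw [Finset.sum_comm, Finset.sum_mul]
  refine Finset.sum_congr rfl fun t _ => ?_
  rw [Finset.sum_mul]
  refine Finset.sum_congr rfl fun x _ => ?_
  rw [Finset.mul_sum]
  refine Finset.sum_congr rfl fun j _ => ?_
  rw [← starRingEnd_apply, map_mul, Complex.conj_conj]
  ring

lemma cst_sq (M : ℕ) (hM : 1 ≤ M) : starRingEnd ℂ (cst M) * cst M * (2 * M) * 8 = 1 := by
  have h1 : (0 : ℝ) < 2 * M := by
    have : (1 : ℝ) ≤ M := by exact_mod_cast hM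
    linarith
  unfold cst
  rw [← Complex.ofReal_mul, Complex.conj_ofReal]
  have : (1 / Real.sqrt (2 * M) * (1 / Real.sqrt 8)) * (1 / Real.sqrt (2 * M) * (1 / Real.sqrt 8))
      * (2 * M) * 8 = 1 := by
    have a := Real.mul_self_sqrt h1.le
    have b := Real.mul_self_sqrt (show (0 : ℝ) ≤ 8 by norm_num)
    have a' := (Real.sqrt_pos.mpr h1).ne'
    have b' := (Real.sqrt_pos.mpr (show (0 : ℝ) < 8 by norm_num)).ne'
    calc _ = (2 * M) / (Real.sqrt (2 * M) * Real.sqrt (2 * M))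
          * (8 / (Real.sqrt 8 * Real.sqrt 8)) := by ring
      _ = 1 := by rw [a, b, div_self h1.ne', div_self (by norm_num), one_mul]
  exact_mod_cast this

lemma Wp_col (n M : ℕ)
    (U : ℕ → Matrix (QState n) (QState n) ℂ)
    (hU : ∀ i, i < M → AllowedGate n (U i)) (t : Fin (2 * M)) (φ φ' : QState n) :
    ∑ x, starRingEnd ℂ (Wpartial n M U t x φ) * Wpartial n M U t x φ'
      = if φ = φ' then 1 else 0 := by
  have := congrFun (congrFun (Wp_unit n M U hU t t.2.le) φ) φ'
  rw [Matrix.mul_apply, Matrix.one_apply] at this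
  exact this

lemma hist_orth (n M : ℕ) (hM : 1 ≤ M)
    (U : ℕ → Matrix (QState n) (QState n) ℂ)
    (hU : ∀ i, i < M → AllowedGate n (U i)) : ∀ b b' : QState n ⊕ QState n,
      dotProduct
          (star (Sum.elim (histVec n M U) (histVecConj n M U) b))
          (Sum.elim (histVec n M U) (histVecConj n M U) b')
        = if b = b' then 1 else 0 := by
  have hc := cst_sq M hM
  have h17 : (1 : Fin 8) ≠ 7 := by decide
  rintro (φ | φ) (φ' | φ') <;>
    simp only [Sum.elim_inl, Sum.elim_inr, hist_sect, histConj_sect, sect_dot, h17, h17.symm,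
      if_true, if_false, mul_zero, reduceCtorEq, Sum.inl.injEq, Sum.inr.injEq]
  · have : ∀ t : Fin (2 * M), ∑ x, starRingEnd ℂ (cst M * Wpartial n M U t x φ)
        * (cst M * Wpartial n M U t x φ')
        = starRingEnd ℂ (cst M) * cst M * if φ = φ' then 1 else 0 := by
      intro t
      rw [← Wp_col n M U hU t, Finset.mul_sum]
      refine Finset.sum_congr rfl fun x _ => ?_
      rw [map_mul]; ring
    simp_rw [this]
    split_ifs
    · simp; linear_combination hc
    · simp
  · have : ∀ t : Fin (2 * M), ∑ x, starRingEnd ℂ (cst M * starRingEnd ℂ (Wpartial n M U t x φ))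
        * (cst M * starRingEnd ℂ (Wpartial n M U t x φ'))
        = starRingEnd ℂ (cst M) * cst M * if φ = φ' then 1 else 0 := by
      intro t
      have h1 : (if φ = φ' then (1 : ℂ) else 0) = if φ' = φ then 1 else 0 := by
        simp only [eq_comm]
      rw [h1, ← Wp_col n M U hU t, Finset.mul_sum]
      refine Finset.sum_congr rfl fun x _ => ?_
      rw [map_mul, Complex.conj_conj]; ring
    simp_rw [this]
    split_ifs
    · simp; linear_combination hc
    · simp

lemma hist_indep (n M : ℕ) (hM : 1 ≤ M)
    (U : ℕ → Matrix (QState n) (QState n) ℂ)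
    (hU : ∀ i, i < M → AllowedGate n (U i)) :
    LinearIndependent ℂ (Sum.elim (histVec n M U) (histVecConj n M U)) := by
  rw [Fintype.linearIndependent_iff]
  intro c hc b
  have h := congrArg (fun w => star (Sum.elim (histVec n M U) (histVecConj n M U) b) ⬝ᵥ w) hc
  simp only [dotProduct_sum, dotProduct_smul, hist_orth n M hM U hU, dotProduct_zero] at h
  simpa using h

/-- Entrywise conjugate gates. -/
noncomputable def conjW (n M : ℕ)
    (U : ℕ → Matrix (QState n) (QState n) ℂ) (t : ℕ) : Matrix (QState n) (QState n) ℂ :=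
  (Wseq n M U t).map (starRingEnd ℂ)

lemma sector1 (n M : ℕ)
    (U : ℕ → Matrix (QState n) (QState n) ℂ)
    (hU : ∀ i, i < M → AllowedGate n (U i)) (f : QState n → Fin (2 * M) → ℂ) :
    (∀ x t, opk n M (Wseq n M U) 1 f x t = (e1 : ℂ) * f x t) ↔
      ∀ s : Fin (2 * M), (fun x => f x (cycSucc s)) = Wseq n M U s *ᵥ fun x => f x s :=
  opk_iff n M (Wseq n M U) (Wseq n M U) 1 (fun t ht => (good_W n M U hU t ht).1) pen_one
    (fun t ht x y => ck_one ((good_W n M U hU t ht).2 x y)) f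

lemma sector7 (n M : ℕ)
    (U : ℕ → Matrix (QState n) (QState n) ℂ)
    (hU : ∀ i, i < M → AllowedGate n (U i)) (f : QState n → Fin (2 * M) → ℂ) :
    (∀ x t, opk n M (Wseq n M U) 7 f x t = (e1 : ℂ) * f x t) ↔
      ∀ s : Fin (2 * M), (fun x => f x (cycSucc s)) = conjW n M U s *ᵥ fun x => f x s := by
  refine opk_iff n M (Wseq n M U) (conjW n M U) 7 (fun t ht => ?_) pen_seven
    (fun t ht x y => ?_) f
  · have h := congrArg (fun A : Matrix (QState n) (QState n) ℂ => A.map (starRingEnd ℂ))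
      (good_W n M U hU t ht).1
    simp only [Matrix.map_mul] at h
    rw [Matrix.map_one _ (map_zero _) (map_one _)] at h
    rw [← h]
    rfl
  · rw [ck_seven ((good_W n M U hU t ht).2 x y), map_mul, map_neg, Complex.conj_ofReal]
    rfl

lemma eig_eq_span (n M : ℕ) (hM : 1 ≤ M)
    (U : ℕ → Matrix (QState n) (QState n) ℂ)
    (hU : ∀ i, i < M → AllowedGate n (U i)) :
    Module.End.eigenspace (HpropC n M U + HpenC n M).mulVecLin ((e1 : ℝ) : ℂ)
        = Submodule.span ℂ (Set.range (Sum.elim (histVec n M U) (histVecConj n M U))) := by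
  apply le_antisymm
  · intro v hv
    rw [Module.End.mem_eigenspace_iff, Matrix.mulVecLin_apply, eig_iff] at hv
    have t0 : (0 : ℕ) < 2 * M := by omega
    have h1 := (sector1 n M U hU _).mp (hv 1)
    have h7 := (sector7 n M U hU _).mp (hv 7)
    have g1 : ∀ t (ht : t < 2 * M), (fun x => four v 1 x ⟨t, ht⟩)
        = Wpartial n M U t *ᵥ fun x => four v 1 x ⟨0, t0⟩ := by
      intro t
      induction t with
      | zero => intro _; simp [Wp_zero]
      | succ t ih =>
        intro ht
        have := h1 ⟨t, by omega⟩
        rw [ih] at this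
        rw [Wp_succ, ← Matrix.mulVec_mulVec, ← this]
        simp only [cycSucc, Nat.mod_eq_of_lt ht]
    have g7 : ∀ t (ht : t < 2 * M), (fun x => four v 7 x ⟨t, ht⟩)
        = (Wpartial n M U t).map (starRingEnd ℂ) *ᵥ fun x => four v 7 x ⟨0, t0⟩ := by
      intro t
      induction t with
      | zero =>
        intro _
        rw [Wp_zero, Matrix.map_one _ (map_zero _) (map_one _), Matrix.one_mulVec]
      | succ t ih =>
        intro ht
        have := h7 ⟨t, by omega⟩
        rw [ih] at this
        rw [Wp_succ, Matrix.map_mul, ← Matrix.mulVec_mulVec]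
        change _ = conjW n M U t *ᵥ _
        rw [← this]
        simp only [cycSucc, Nat.mod_eq_of_lt ht]
    have hc0 : cst M ≠ 0 := by
      intro h
      have := cst_sq M hM
      rw [h] at this
      simp at this
    have hv2 : v = ∑ φ, (four v 1 φ ⟨0, t0⟩ / (8 * cst M)) • histVec n M U φ
        + ∑ φ, (four v 7 φ ⟨0, t0⟩ / (8 * cst M)) • histVecConj n M U φ := by
      funext ⟨x, t, j⟩
      have inv := four_inv v x t j
      have hz : ∀ k, k ≠ 1 → k ≠ 7 → four v k x t = 0 := fun k a b =>
        opk_zero n M _ (good_W n M U hU) k a b _ (hv k) x t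
      have h17 : (1 : Fin 8) ≠ 7 := by decide
      rw [Finset.sum_eq_add (1 : Fin 8) 7 h17 (fun k _ hk => by rw [hz k hk.1 hk.2, zero_mul])
        (by simp) (by simp)] at inv
      have e1' := congrFun (g1 t t.2) x
      have e7' := congrFun (g7 t t.2) x
      simp only [Matrix.mulVec, dotProduct, Matrix.map_apply, Fin.eta] at e1' e7'
      simp only [Pi.add_apply, Finset.sum_apply, Pi.smul_apply, smul_eq_mul, hist_sect,
        histConj_sect, sect]
      have s1 : ∑ φ, four v 1 φ ⟨0, t0⟩ / (8 * cst M) *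
          (cst M * Wpartial n M U t x φ * starRingEnd ℂ (chi 1 j))
          = four v 1 x t * starRingEnd ℂ (chi 1 j) / 8 := by
        rw [e1', Finset.sum_mul, Finset.sum_div]
        refine Finset.sum_congr rfl fun φ _ => ?_
        field_simp
      have s7 : ∑ φ, four v 7 φ ⟨0, t0⟩ / (8 * cst M) *
          (cst M * starRingEnd ℂ (Wpartial n M U t x φ) * starRingEnd ℂ (chi 7 j))
          = four v 7 x t * starRingEnd ℂ (chi 7 j) / 8 := by
        rw [e7', Finset.sum_mul, Finset.sum_div]
        refine Finset.sum_congr rfl fun φ _ => ?_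
        field_simp
      rw [s1, s7]
      linear_combination inv / 8
    rw [hv2]
    refine Submodule.add_mem _ (Submodule.sum_mem _ fun φ _ => Submodule.smul_mem _ _ ?_)
      (Submodule.sum_mem _ fun φ _ => Submodule.smul_mem _ _ ?_)
    · exact Submodule.subset_span ⟨Sum.inl φ, rfl⟩
    · exact Submodule.subset_span ⟨Sum.inr φ, rfl⟩
  · rw [Submodule.span_le]
    rintro _ ⟨φ | φ, rfl⟩
    · rw [SetLike.mem_coe, Module.End.mem_eigenspace_iff, Matrix.mulVecLin_apply, eig_iff]
      simp only [Sum.elim_inl, hist_sect]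
      intro k
      by_cases hk : k = 1
      · subst hk
        rw [sector1 n M U hU]
        intro s
        funext x
        simp only [four_sect, if_true, Wp_cyc n M U hU, Matrix.mulVec, dotProduct,
          Matrix.mul_apply, Finset.mul_sum]
        exact Finset.sum_congr rfl fun y _ => by ring
      · intro x t
        simp [opk, four_sect, hk]
    · rw [SetLike.mem_coe, Module.End.mem_eigenspace_iff, Matrix.mulVecLin_apply, eig_iff]
      simp only [Sum.elim_inr, histConj_sect]
      intro k
      by_cases hk : k = 7
      · subst hk
        rw [sector7 n M U hU]
        intro s
        funext x
        simp only [four_sect, if_true, Wp_cyc n M U hU, Matrix.mulVec, dotProduct,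
          Matrix.mul_apply, Finset.mul_sum, conjW, Matrix.map_apply, map_sum, map_mul]
        exact Finset.sum_congr rfl fun y _ => by ring
      · intro x t
        simp [opk, four_sect, hk]

end QC

open QC

/-- The eigenspace of `H_prop + H_penalty` with eigenvalue
`e₁ = −1 − 3√2` has dimension `2^{n+1}` and admits the orthonormal basis consisting of
the vectors `(1/√(2M)) Σ_t (W_{t−1}⋯W₁ φ) ⊗ |t⟩ ⊗ |ω⟩` together with the vectors
`(1/√(2M)) Σ_t ((W_{t−1}⋯W₁)^* φ) ⊗ |t⟩ ⊗ |ω*⟩`, where `φ` ranges over the `2^n`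
computational basis vectors of `(ℂ²)^{⊗n}`. -/
theorem hprop_hpenalty_ground_space
    (n M : ℕ) (hn : 1 ≤ n) (hM : 1 ≤ M)
    (U : ℕ → Matrix (QState n) (QState n) ℂ)
    (hU : ∀ i, i < M → AllowedGate n (U i)) :
    (∀ b b' : QState n ⊕ QState n,
      dotProduct
          (star (Sum.elim (histVec n M U) (histVecConj n M U) b))
          (Sum.elim (histVec n M U) (histVecConj n M U) b')
        = if b = b' then 1 else 0)
    ∧ Module.End.eigenspace (HpropC n M U + HpenC n M).mulVecLin ((e1 : ℝ) : ℂ)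
        = Submodule.span ℂ (Set.range (Sum.elim (histVec n M U) (histVecConj n M U)))
    ∧ Module.finrank ℂ
        (Module.End.eigenspace (HpropC n M U + HpenC n M).mulVecLin ((e1 : ℝ) : ℂ))
        = 2 ^ (n + 1) := by
  refine ⟨hist_orth n M hM U hU, eig_eq_span n M hM U hU, ?_⟩
  rw [eig_eq_span n M hM U hU, finrank_span_eq_card (hist_indep n M hM U hU)]
  simp [pow_succ]
  ring
end
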